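/- Let n ≥ 18 be even and let F be an intersecting butterfly-free family of subsets of [n] with |F| = Σ_I(n,2). Then there exists x ∈ [n] such that F = H_{x,n,2}, i.e., F = {S ⊆ [n] : |S| = n/2 and x ∈ S} ∪ {S ⊆ [n] : |S| = n/2+1} ∪ {S ⊆ [n] : |S| = n/2+2 and x ∉ S}. -/

import Mathlib

/-- `Σ_I(n,k)` from the paper. -/
def SigmaI (n k : ℕ) : ℕ :=
  if n % 2 = 1 then
    ∑ i ∈ Finset.Icc ((n + 1) / 2) ((n + 1) / 2 + k - 1), Nat.choose n i
  else
    Nat.choose (n - 1) (n / 2 - 1) +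
      ∑ i ∈ Finset.Icc (n / 2 + 1) (n / 2 + k - 1), Nat.choose n i +
      Nat.choose (n - 1) (n / 2 + k)

/-- A family of finite sets is intersecting if any two members meet. -/
def Intersecting {α : Type*} [DecidableEq α] (F : Finset (Finset α)) : Prop :=
  ∀ A ∈ F, ∀ B ∈ F, (A ∩ B).Nonempty

/-- A family is butterfly-free if there are no four distinct members
`A,B,C,D` with `A ⊆ C`, `A ⊆ D`, `B ⊆ C`, `B ⊆ D`. -/
def ButterflyFree {α : Type*} (F : Finset (Finset α)) : Prop :=
  ¬ ∃ A B C D : Finset α, A ∈ F ∧ B ∈ F ∧ C ∈ F ∧ D ∈ F ∧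
    A ≠ B ∧ A ≠ C ∧ A ≠ D ∧ B ≠ C ∧ B ≠ D ∧ C ≠ D ∧
    A ⊆ C ∧ A ⊆ D ∧ B ⊆ C ∧ B ⊆ D

/-- A family is `k`-Sperner if it contains no chain of `k+1` distinct sets. -/
def KSperner {α : Type*} (k : ℕ) (F : Finset (Finset α)) : Prop :=
  ¬ ∃ c : Fin (k + 1) → Finset α, (∀ i, c i ∈ F) ∧ StrictMono c

/-- `g s k` says that the arc of `k` consecutive points of `ZMod n` starting at `s` is selected.
Selected arcs are proper, pairwise intersecting, and contain no chain of three arcs. -/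
structure IsArcFamily {n : ℕ} (g : ZMod n → ℕ → Prop) : Prop where
  pos : ∀ {s k}, g s k → 0 < k
  lt : ∀ {s k}, g s k → k < n
  inter : ∀ {s k i l}, g s k → g (s + (i : ℕ)) l → k ≤ i → i + l ≤ n → False
  sperner : ∀ {s l i k j r}, g s l → g (s + (i : ℕ)) k → g (s + (i : ℕ) + (j : ℕ)) r →
    i + k ≤ l → k < l → j + r ≤ k → r < k → False

open scoped Classical in
/-- Lengths of the selected arcs that start at `s`. -/
noncomputable def startLengths {n : ℕ} (g : ZMod n → ℕ → Prop) (s : ZMod n) : Finset ℕ :=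
  (Finset.range n).filter (g s)

open scoped Classical in
/-- Lengths of the selected arcs that end just before `s`. -/
noncomputable def endLengths {n : ℕ} (g : ZMod n → ℕ → Prop) (s : ZMod n) : Finset ℕ :=
  (Finset.range n).filter (fun l => g (s - (l : ℕ)) l)

/-- The mirror image of a selection of arcs. -/
def reflectArcs {n : ℕ} (g : ZMod n → ℕ → Prop) (s : ZMod n) (k : ℕ) : Prop :=
  g (-s - (k : ℕ)) k

namespace IsArcFamily

variable {n : ℕ} {g : ZMod n → ℕ → Prop}

lemma mem_startLengths (hg : IsArcFamily g) {s : ZMod n} {k : ℕ} :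
    k ∈ startLengths g s ↔ g s k := by
  simp only [startLengths, Finset.mem_filter, Finset.mem_range]
  exact ⟨fun h => h.2, fun h => ⟨hg.lt h, h⟩⟩

lemma mem_endLengths (hg : IsArcFamily g) {s : ZMod n} {k : ℕ} :
    k ∈ endLengths g s ↔ g (s - (k : ℕ)) k := by
  simp only [endLengths, Finset.mem_filter, Finset.mem_range]
  exact ⟨fun h => h.2, fun h => ⟨hg.lt h, h⟩⟩

lemma lt_add_of_start_end (hg : IsArcFamily g) {s : ZMod n} {k l : ℕ}
    (hk : g s k) (hl : g (s - (l : ℕ)) l) : n < k + l := by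
  by_contra! h
  have hln : l ≤ n := by omega
  refine hg.inter (i := n - l) hk (l := l) ?_ (by omega) (by omega)
  convert hl using 1
  push_cast [Nat.cast_sub hln]
  simp [sub_eq_add_neg]

lemma reflect (hg : IsArcFamily g) : IsArcFamily (reflectArcs g) where
  pos h := hg.pos h
  lt h := hg.lt h
  inter {s k i l} h₁ h₂ h₃ h₄ := by
    refine hg.inter (i := i + l - k) h₂ (l := k) ?_ (by omega) (by omega)
    unfold reflectArcs at h₁
    convert h₁ using 1
    rw [Nat.cast_sub (by omega)]
    push_cast
    ring
  sperner {s l i k j r} h₁ h₂ h₃ h₄ h₅ h₆ h₇ := by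
    unfold reflectArcs at h₁ h₂ h₃
    refine hg.sperner (i := l - i - k) (k := k) (j := k - j - r) (r := r) h₁ ?_ ?_
      (by omega) h₅ (by omega) h₇
    · convert h₂ using 1
      rw [Nat.cast_sub (by omega), Nat.cast_sub (by omega)]
      ring
    · convert h₃ using 1
      rw [Nat.cast_sub (by omega), Nat.cast_sub (by omega), Nat.cast_sub (by omega),
        Nat.cast_sub (by omega)]
      ring

lemma startLengths_reflect (s : ZMod n) :
    startLengths (reflectArcs g) s = endLengths g (-s) := rfl

lemma endLengths_reflect (s : ZMod n) :
    endLengths (reflectArcs g) s = startLengths g (-s) := by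
  classical
  ext k
  have : -(s - (k : ZMod n)) - k = -s := by ring
  refine Finset.mem_filter.trans (Iff.trans ?_ Finset.mem_filter.symm)
  rw [reflectArcs, this]

lemma no_three_start (hg : IsArcFamily g) {s : ZMod n} {a b c : ℕ} (hab : a < b) (hbc : b < c)
    (ha : g s a) (hb : g s b) (hc : g s c) : False :=
  hg.sperner (i := 0) (j := 0) hc (by simpa using hb) (by simpa using ha) (by omega) hbc
    (by omega) hab

lemma card_startLengths_le (hg : IsArcFamily g) (s : ZMod n) : (startLengths g s).card ≤ 2 := by
  by_contra! h
  obtain ⟨a, ha, b, hb, c, hc, hab, hac, hbc⟩ := Finset.two_lt_card.mp h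
  rw [hg.mem_startLengths] at ha hb hc
  rcases lt_or_gt_of_ne hab with h₁ | h₁ <;> rcases lt_or_gt_of_ne hac with h₂ | h₂ <;>
    rcases lt_or_gt_of_ne hbc with h₃ | h₃ <;>
    first
    | omega
    | exact hg.no_three_start ‹_› ‹_› ha hb hc
    | exact hg.no_three_start ‹_› ‹_› ha hc hb
    | exact hg.no_three_start ‹_› ‹_› hb ha hc
    | exact hg.no_three_start ‹_› ‹_› hb hc ha
    | exact hg.no_three_start ‹_› ‹_› hc ha hb
    | exact hg.no_three_start ‹_› ‹_› hc hb ha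

lemma card_endLengths_le (hg : IsArcFamily g) (s : ZMod n) : (endLengths g s).card ≤ 2 := by
  have := hg.reflect.card_startLengths_le (-s)
  rwa [startLengths_reflect, neg_neg] at this

lemma exists_lt_of_two_le (hg : IsArcFamily g) {s : ZMod n} (h : 2 ≤ (startLengths g s).card) :
    ∃ a b, a < b ∧ g s a ∧ g s b := by
  obtain ⟨a, ha, b, hb, hab⟩ := Finset.one_lt_card.mp h
  rw [hg.mem_startLengths] at ha hb
  rcases lt_or_gt_of_ne hab with h | h
  · exact ⟨a, b, h, ha, hb⟩
  · exact ⟨b, a, h, hb, ha⟩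

lemma sum_startLengths_eq_sum_endLengths [NeZero n] {R : Type*} [AddCommMonoid R] (f : ℕ → R) :
    ∑ s, ∑ k ∈ startLengths g s, f k = ∑ s, ∑ k ∈ endLengths g s, f k := by
  classical
  simp only [startLengths, endLengths, Finset.sum_filter]
  rw [Finset.sum_comm, Finset.sum_comm (s := Finset.univ)]
  refine Finset.sum_congr rfl fun l _ => ?_
  exact (Equiv.sum_comp (Equiv.subRight ((l : ℕ) : ZMod n))
    (fun s => @ite _ (g s l) (Classical.propDecidable _) (f l) 0)).symm

/-- If all points but `t` start two selected arcs, and `t` starts one, then no other point starts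
both an arc of half length and one that is one longer. -/
lemma not_half_and_succ (hg : IsArcFamily g) {m : ℕ} (hn : n = 2 * m) (hm : 2 ≤ m)
    {s t : ZMod n} (hst : s ≠ t) (htwo : ∀ u, u ≠ t → 2 ≤ (startLengths g u).card)
    (hone : (startLengths g t).Nonempty) (h₁ : g s m) (h₂ : g s (m + 1)) : False := by
  have : NeZero n := ⟨by omega⟩
  have hn0 : ((n : ℕ) : ZMod n) = 0 := ZMod.natCast_self n
  have key : ∀ u, ∃ a b, u ≠ t → a < b ∧ g u a ∧ g u b := by
    intro u
    by_cases hu : u = t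
    · exact ⟨0, 0, fun h => (h hu).elim⟩
    · obtain ⟨a, b, h⟩ := hg.exists_lt_of_two_le (htwo u hu)
      exact ⟨a, b, fun _ => h⟩
  choose a b hab using key
  have hs := hab s hst
  have has : a s ≤ m := by
    by_contra! h
    exact hg.no_three_start (Nat.lt_succ_self m) (show m + 1 < b s by omega) h₁ h₂ hs.2.2
  have hbs : b s ≤ m + 1 := by
    by_contra! h
    exact hg.no_three_start (Nat.lt_succ_self m) h h₁ h₂ hs.2.2
  set u : ℕ → ZMod n := fun j => t + 1 + (j : ℕ) with hu
  have hut : ∀ j, j + 1 < n → u j ≠ t := by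
    intro j hj h
    have h' : ((j + 1 : ℕ) : ZMod n) = 0 := by
      have : u j - t = 0 := by rw [h, sub_self]
      rw [← this, hu]; push_cast; ring
    rw [ZMod.natCast_eq_zero_iff] at h'
    exact absurd (Nat.le_of_dvd (by omega) h') (by omega)
  have husucc : ∀ j, u (j + 1) = u j + ((1 : ℕ) : ZMod n) := by
    intro j; simp only [hu]; push_cast; ring
  have mono : ∀ j, j + 2 < n → a (u j) ≤ a (u (j + 1)) ∧ b (u j) ≤ b (u (j + 1)) := by
    intro j hj
    obtain ⟨x1, x2, x3⟩ := hab (u j) (hut j (by omega))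
    obtain ⟨y1, y2, y3⟩ := hab (u (j + 1)) (hut (j + 1) (by omega))
    generalize a (u (j + 1)) = A at *
    generalize b (u (j + 1)) = B at *
    rw [husucc j] at y2 y3
    constructor
    · by_contra! h
      refine hg.sperner (i := 0) (j := 1) x3 (by simpa using x2) (r := A) ?_
        (by omega) x1 (by omega) h
      simpa using y2
    · by_contra! h
      refine hg.sperner (i := 1) (j := 0) x3 y3 (r := A) ?_
        (by omega) h (by omega) y1
      simpa using y2
  have mono' : ∀ d j, j + d + 1 < n → a (u j) ≤ a (u (j + d)) ∧ b (u j) ≤ b (u (j + d)) := by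
    intro d
    induction d with
    | zero => intro j _; simp
    | succ d ih =>
      intro j hj
      have h1 := ih j (by omega)
      have h2 := mono (j + d) (by omega)
      rw [show j + (d + 1) = j + d + 1 by ring]
      exact ⟨h1.1.trans h2.1, h1.2.trans h2.2⟩
  obtain ⟨j, hj, hsj⟩ : ∃ j, j + 1 < n ∧ u j = s := by
    refine ⟨(s - (t + 1)).val, ?_, ?_⟩
    · have hlt := ZMod.val_lt (s - (t + 1))
      by_contra! h
      have hv : (s - (t + 1)).val = n - 1 := by omega
      have : s - (t + 1) = ((n - 1 : ℕ) : ZMod n) := by rw [← hv, ZMod.natCast_zmod_val]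
      rw [Nat.cast_sub (by omega), hn0] at this
      apply hst
      linear_combination this
    · simp only [hu, ZMod.natCast_zmod_val]; ring
  obtain ⟨e1, e2⟩ := mono' j 0 (by omega)
  rw [Nat.zero_add, hsj] at e1 e2
  have f0 := hab (u 0) (hut 0 (by omega))
  have fm := hab (u m) (hut m (by omega))
  have fl := hab (u (2 * m - 2)) (hut (2 * m - 2) (by omega))
  have hum : u m = u 0 + ((m : ℕ) : ZMod n) := by simp [hu]
  have ham : m + 1 ≤ a (u m) := by
    by_contra! h
    have h2 := fm.2.1
    rw [hum] at h2
    exact hg.inter f0.2.1 h2 (by omega) (by rw [hum] at h; omega)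
  obtain ⟨e3, e4⟩ := mono' (m - 2) m (by omega)
  rw [show m + (m - 2) = 2 * m - 2 by omega] at e3 e4
  have hut1 : u (2 * m - 2) + ((1 : ℕ) : ZMod n) = t := by
    simp only [hu]
    rw [Nat.cast_sub (by omega), ← hn, hn0]
    push_cast; ring
  have hu0 : u 0 = t + ((1 : ℕ) : ZMod n) := by simp [hu]
  have hu02 : u 0 = u (2 * m - 2) + ((2 : ℕ) : ZMod n) := by
    rw [hu0, ← hut1]; push_cast; ring
  have hadrop : a (u (2 * m - 2)) ≤ a (u 0) + 1 := by
    by_contra! h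
    have f1 := f0.2.1
    rw [hu02] at f1
    refine hg.sperner (i := 0) (j := 2) fl.2.2 (by simpa using fl.2.1)
      (r := a (u 0)) ?_ (by omega) fl.1 (by omega) (by omega)
    rw [hu02]
    simpa using f1
  have hbdrop : b (u (2 * m - 2)) ≤ b (u 0) + 1 := by
    by_contra! h
    have f1 := f0.2.1
    have f2 := f0.2.2
    refine hg.sperner (i := 2) (j := 0) fl.2.2 (k := b (u 0)) (r := a (u 0)) ?_ ?_
      (by omega) (by omega) (by omega) f0.1
    · rw [← hu02]; exact f2
    · rw [← hu02]; simpa using f1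
  have q1 : a (u 0) = m := by omega
  have q2 : b (u 0) = m + 1 := by omega
  have q3 : a (u (2 * m - 2)) = m + 1 := by omega
  have q4 : b (u (2 * m - 2)) = m + 2 := by omega
  rw [q1, q2, hu0] at f0
  rw [q3, q4] at fl
  obtain ⟨x, hx⟩ := hone
  rw [hg.mem_startLengths] at hx
  have hx1 : x ≤ m + 1 := by
    by_contra! h
    exact hg.sperner (i := 1) (j := 0) hx f0.2.2 (r := m) (by simpa using f0.2.1)
      (by omega) h (by omega) (by omega)
  have hx2 : m + 1 ≤ x := by
    by_contra! h
    refine hg.sperner (i := 0) (j := 1) fl.2.2 (by simpa using fl.2.1) (r := x) ?_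
      (by omega) (by omega) (by omega) h
    rw [← hut1] at hx
    simpa using hx
  obtain rfl : x = m + 1 := by omega
  refine hg.sperner (i := 1) (j := 1) fl.2.2 (k := m + 1) (r := m) (by rw [hut1]; exact hx) ?_
    (by omega) (by omega) (by omega) (by omega)
  rw [hut1]
  exact f0.2.1

end IsArcFamily

lemma choose_anti_of_half_le {n m : ℕ} (hn : n = 2 * m) {j k : ℕ} (hj : m ≤ j) (hjk : j ≤ k) :
    n.choose k ≤ n.choose j := by
  induction k, hjk using Nat.le_induction with
  | base => exact le_rfl
  | succ k hk ih =>
    refine le_trans ?_ ih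
    have h := Nat.choose_succ_right_eq n k
    by_contra! hlt
    have h2 : n.choose k * (n - k) ≤ n.choose k * (k + 1) := Nat.mul_le_mul_left _ (by omega)
    have h3 : n.choose k * (k + 1) < n.choose (k + 1) * (k + 1) :=
      Nat.mul_lt_mul_of_pos_right hlt (by omega)
    omega

lemma choose_le_of_two_le_dist {n m : ℕ} (hn : n = 2 * m) {k : ℕ} (hk : k + 2 ≤ m ∨ m + 2 ≤ k) :
    n.choose k ≤ n.choose (m + 2) := by
  rcases hk with hk | hk
  · rw [← Nat.choose_symm (show k ≤ n by omega)]
    exact choose_anti_of_half_le hn (by omega) (by omega)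
  · exact choose_anti_of_half_le hn (by omega) hk

lemma choose_half_sub_one {n m : ℕ} (hn : n = 2 * m) (hm : 1 ≤ m) :
    n.choose (m - 1) = n.choose (m + 1) := by
  rw [← Nat.choose_symm (show m - 1 ≤ n by omega)]
  congr 1
  omega

lemma choose_half_succ {n m : ℕ} (hn : n = 2 * m) (i : ℕ) (hi : i ≤ m) :
    (n.choose (m + (i + 1)) : ℝ) * (m + i + 1) = n.choose (m + i) * (m - i) := by
  have h := Nat.choose_succ_right_eq n (m + i)
  rw [show n - (m + i) = m - i by omega] at h
  have h' : ((n.choose (m + i + 1) * (m + i + 1) : ℕ) : ℝ) =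
      ((n.choose (m + i) * (m - i) : ℕ) : ℝ) := by rw [h]
  push_cast [Nat.cast_sub hi] at h'
  exact h'

/-- The difference between the binomial coefficients at distance one and two from the middle. -/
noncomputable def chooseGap (m : ℕ) : ℝ :=
  ((2 * m).choose (m + 1) : ℝ) - (2 * m).choose (m + 2)

lemma chooseGap_mul (m : ℕ) (hm : 3 ≤ m) :
    chooseGap m * (m - 1) = 3 * (2 * m).choose (m + 2) ∧
    chooseGap m * ((m + 1) * (m + 2)) = 3 * m * (2 * m).choose m := by
  have h1 := choose_half_succ (m := m) rfl 0 (by omega)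
  have h2 := choose_half_succ (m := m) rfl 1 (by omega)
  norm_num at h1 h2
  unfold chooseGap
  constructor
  · linear_combination (-1 : ℝ) * h2
  · linear_combination (-(m + 1) : ℝ) * h2 + 3 * h1

lemma chooseGap_facts {m : ℕ} (hm : 9 ≤ m) :
    0 < chooseGap m ∧ chooseGap m ≤ ((2 * m).choose m : ℝ) - (2 * m).choose (m + 2) ∧
    chooseGap m ≤ ((2 * m).choose (m + 2) : ℝ) - (2 * m).choose (m + 3) ∧
    4 * ((2 * m).choose (m + 2) : ℝ) ≤ (2 * m - 2) * chooseGap m ∧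
    3 * chooseGap m ≤ 2 * ((2 * m).choose (m + 2) : ℝ) := by
  have h1 := choose_half_succ (m := m) rfl 0 (by omega)
  have h3 := choose_half_succ (m := m) rfl 2 (by omega)
  have hg := chooseGap_mul m (by omega)
  norm_num at h1 h3
  have hm' : (9 : ℝ) ≤ m := by exact_mod_cast hm
  have hc : (0 : ℝ) < (2 * m).choose (m + 2) := by
    exact_mod_cast Nat.choose_pos (by omega)
  have hc0 : (0 : ℝ) < (2 * m).choose m := by
    exact_mod_cast Nat.choose_pos (by omega)
  have hpos : 0 < chooseGap m := by
    by_contra! h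
    nlinarith [hg.1]
  have h10 : ((2 * m).choose (m + 1) : ℝ) ≤ (2 * m).choose m := by
    exact_mod_cast choose_anti_of_half_le (m := m) rfl le_rfl (by omega)
  refine ⟨hpos, ?_, ?_, ?_, ?_⟩
  · unfold chooseGap; linarith
  · have h4 : (((2 * m).choose (m + 2) : ℝ) - (2 * m).choose (m + 3)) * (m + 3) =
        5 * (2 * m).choose (m + 2) := by linear_combination (-1 : ℝ) * h3
    by_contra! h
    nlinarith [hg.1]
  · nlinarith [hg.1]
  · nlinarith [hg.1]

/-- The lengths `C` of arcs starting at a point and `D` of arcs ending just before it attain the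
optimum weight, with the shorter arcs on the side of `C`. -/
def HalfTight (m : ℕ) (C D : Finset ℕ) : Prop :=
  m ∈ C ∧ m + 1 ∈ C ∧ m + 1 ∈ D ∧ ∀ l ∈ D, l = m + 1 ∨ l = m + 2

def IsTight (m : ℕ) (C D : Finset ℕ) : Prop := HalfTight m C D ∨ HalfTight m D C

section Pair

variable {m : ℕ} {v : ℕ → ℝ} {d₀ d₁ : ℝ}

lemma sum_le_middle (hm : 1 ≤ m) (h0 : v m = d₀) (h1 : v (m + 1) = d₁) (h1' : v (m - 1) = d₁)
    (hneg : ∀ k, k + 2 ≤ m ∨ m + 2 ≤ k → v k ≤ 0) (C : Finset ℕ) :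
    ∑ k ∈ C, v k ≤ (if m - 1 ∈ C then d₁ else 0) + (if m ∈ C then d₀ else 0) +
      (if m + 1 ∈ C then d₁ else 0) := by
  have : ∀ k ∈ C, v k ≤ (if k = m - 1 then d₁ else 0) + (if k = m then d₀ else 0) +
      (if k = m + 1 then d₁ else 0) := by
    intro k _
    rcases (by omega : k = m - 1 ∨ k = m ∨ k = m + 1 ∨ (k + 2 ≤ m ∨ m + 2 ≤ k)) with h | h | h | h
    · simp [h, h1', show m - 1 ≠ m by omega, show m - 1 ≠ m + 1 by omega]
    · simp [h, h0, show m ≠ m - 1 by omega]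
    · simp [h, h1, show m + 1 ≠ m - 1 by omega]
    · simpa [show k ≠ m - 1 by omega, show k ≠ m by omega, show k ≠ m + 1 by omega]
        using hneg k h
  refine (Finset.sum_le_sum this).trans (le_of_eq ?_)
  simp [Finset.sum_add_distrib, Finset.sum_ite_eq']

lemma sum_le_of_half_succ (hm : 1 ≤ m) (h0 : v m = d₀) (h1 : v (m + 1) = d₁)
    (h2 : v (m + 2) = 0) (hneg' : ∀ k, m + 3 ≤ k → v k ≤ -d₁)
    {C D : Finset ℕ} (hC : C.card ≤ 2) (hD : D.card ≤ 2)
    (hcross : ∀ k ∈ C, ∀ l ∈ D, 2 * m < k + l) (ha : m ∈ C) (hb : m + 1 ∈ C) (hc : m + 1 ∈ D) :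
    (HalfTight m C D ∧ ∑ k ∈ C, v k + ∑ k ∈ D, v k = d₀ + 2 * d₁) ∨
      ∑ k ∈ C, v k + ∑ k ∈ D, v k ≤ d₀ + d₁ := by
  have hCeq : C = {m, m + 1} := by
    symm
    apply Finset.eq_of_subset_of_card_le
    · intro x hx
      simp only [Finset.mem_insert, Finset.mem_singleton] at hx
      rcases hx with rfl | rfl <;> assumption
    · rw [Finset.card_pair (by omega)]; exact hC
  have hCs : ∑ k ∈ C, v k = d₀ + d₁ := by
    rw [hCeq, Finset.sum_pair (by omega), h0, h1]
  by_cases hD1 : D = {m + 1}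
  · left
    refine ⟨⟨ha, hb, hc, fun l hl => ?_⟩, ?_⟩
    · rw [hD1] at hl; left; simpa using hl
    · rw [hCs, hD1, Finset.sum_singleton, h1]; ring
  · obtain ⟨l, hl, hne⟩ : ∃ l ∈ D, l ≠ m + 1 := by
      by_contra! h
      exact hD1 (Finset.eq_singleton_iff_unique_mem.mpr ⟨hc, h⟩)
    have hDeq : D = {m + 1, l} := by
      symm
      apply Finset.eq_of_subset_of_card_le
      · intro x hx
        simp only [Finset.mem_insert, Finset.mem_singleton] at hx
        rcases hx with rfl | rfl <;> assumption
      · rw [Finset.card_pair (by omega)]; exact hD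
    have hDs : ∑ k ∈ D, v k = d₁ + v l := by
      rw [hDeq, Finset.sum_pair (by omega), h1]
    have := hcross m ha l hl
    by_cases hl2 : l = m + 2
    · left
      refine ⟨⟨ha, hb, hc, fun x hx => ?_⟩, ?_⟩
      · rw [hDeq] at hx
        simp only [Finset.mem_insert, Finset.mem_singleton] at hx
        omega
      · rw [hCs, hDs, hl2, h2]; ring
    · right
      have := hneg' l (by omega)
      rw [hCs, hDs]; linarith

lemma tight_or_sum_le (hm : 1 ≤ m) (h0 : v m = d₀) (h1 : v (m + 1) = d₁) (h1' : v (m - 1) = d₁)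
    (h2 : v (m + 2) = 0) (hd₁ : 0 ≤ d₁) (hd : d₁ ≤ d₀)
    (hneg : ∀ k, k + 2 ≤ m ∨ m + 2 ≤ k → v k ≤ 0) (hneg' : ∀ k, m + 3 ≤ k → v k ≤ -d₁)
    {C D : Finset ℕ} (hC : C.card ≤ 2) (hD : D.card ≤ 2)
    (hcross : ∀ k ∈ C, ∀ l ∈ D, 2 * m < k + l) :
    (IsTight m C D ∧ ∑ k ∈ C, v k + ∑ k ∈ D, v k = d₀ + 2 * d₁) ∨
      ∑ k ∈ C, v k + ∑ k ∈ D, v k ≤ d₀ + d₁ := by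
  by_cases hA : m ∈ C ∧ m + 1 ∈ C ∧ m + 1 ∈ D
  · rcases sum_le_of_half_succ hm h0 h1 h2 hneg' hC hD hcross hA.1 hA.2.1 hA.2.2 with h | h
    · exact Or.inl ⟨Or.inl h.1, h.2⟩
    · exact Or.inr h
  by_cases hB : m ∈ D ∧ m + 1 ∈ D ∧ m + 1 ∈ C
  · rcases sum_le_of_half_succ hm h0 h1 h2 hneg' hD hC
      (fun k hk l hl => by have := hcross l hl k hk; omega) hB.1 hB.2.1 hB.2.2 with h | h
    · exact Or.inl ⟨Or.inr h.1, by rw [add_comm]; exact h.2⟩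
    · exact Or.inr (by rw [add_comm]; exact h)
  right
  have hnot : ∀ E : Finset ℕ, E.card ≤ 2 → ¬ (m - 1 ∈ E ∧ m ∈ E ∧ m + 1 ∈ E) := by
    rintro E hE ⟨x, y, z⟩
    have : 2 < E.card :=
      Finset.two_lt_card.mpr ⟨_, x, _, y, _, z, by omega, by omega, by omega⟩
    omega
  have hC3 := hnot C hC
  have hD3 := hnot D hD
  have bC := sum_le_middle hm h0 h1 h1' hneg C
  have bD := sum_le_middle hm h0 h1 h1' hneg D
  have x1 : m - 1 ∈ C → m - 1 ∉ D := fun a b => by have := hcross _ a _ b; omega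
  have x2 : m - 1 ∈ C → m ∉ D := fun a b => by have := hcross _ a _ b; omega
  have x3 : m - 1 ∈ C → m + 1 ∉ D := fun a b => by have := hcross _ a _ b; omega
  have x4 : m ∈ C → m - 1 ∉ D := fun a b => by have := hcross _ a _ b; omega
  have x5 : m ∈ C → m ∉ D := fun a b => by have := hcross _ a _ b; omega
  have x6 : m + 1 ∈ C → m - 1 ∉ D := fun a b => by have := hcross _ a _ b; omega
  clear hcross hneg hneg' hnot hC hD
  by_cases a1 : m - 1 ∈ C
  · simp only [x1 a1, x2 a1, x3 a1, if_false] at bD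
    split_ifs at bC <;> first | linarith | exact absurd ⟨a1, ‹_›, ‹_›⟩ hC3
  by_cases b1 : m - 1 ∈ D
  · have y2 : m ∉ C := fun h => x4 h b1
    have y3 : m + 1 ∉ C := fun h => x6 h b1
    simp only [a1, y2, y3, if_false] at bC
    split_ifs at bD <;> first | linarith | exact absurd ⟨b1, ‹_›, ‹_›⟩ hD3
  simp only [a1, if_false] at bC
  simp only [b1, if_false] at bD
  by_cases a2 : m ∈ C
  · simp only [a2, x5 a2, if_true, if_false] at bC bD
    split_ifs at bC bD <;> first | linarith | exact absurd ⟨a2, ‹_›, ‹_›⟩ hA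
  · simp only [a2, if_false] at bC
    split_ifs at bC bD <;> first | linarith | exact absurd ⟨‹_›, ‹_›, ‹_›⟩ hB

end Pair

/-- The number of selected arcs. -/
noncomputable def arcCount {n : ℕ} [NeZero n] (g : ZMod n → ℕ → Prop) : ℕ :=
  ∑ s, (startLengths g s).card

/-- The selected arcs, each weighted by the number of sets of its size. -/
noncomputable def arcWeight {n : ℕ} [NeZero n] (g : ZMod n → ℕ → Prop) : ℝ :=
  ∑ s, ∑ k ∈ startLengths g s, (n.choose k : ℝ)

/-- Twice the difference between the weight of the extremal configuration and that of `g`. -/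
noncomputable def arcDeficit (m : ℕ) [NeZero (2 * m)] (g : ZMod (2 * m) → ℕ → Prop) : ℝ :=
  2 * (m * ((2 * m).choose m : ℝ) + 2 * m * (2 * m).choose (m + 1) +
    (m - 2) * (2 * m).choose (m + 2)) - 2 * arcWeight g

/-- The loss in weight at the point `s`. -/
noncomputable def pointLoss {m : ℕ} (g : ZMod (2 * m) → ℕ → Prop) (s : ZMod (2 * m)) : ℝ :=
  (((2 * m).choose m : ℝ) - (2 * m).choose (m + 2)) + 2 * chooseGap m -
    (∑ k ∈ startLengths g s, (((2 * m).choose k : ℝ) - (2 * m).choose (m + 2)) +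
      ∑ k ∈ endLengths g s, (((2 * m).choose k : ℝ) - (2 * m).choose (m + 2)))

/-- Every point is tight, and the number of selected arcs is that of the extremal configuration. -/
def IsPerfect (m : ℕ) [NeZero (2 * m)] (g : ZMod (2 * m) → ℕ → Prop) : Prop :=
  (∀ s, IsTight m (startLengths g s) (endLengths g s)) ∧ arcCount g + 2 = 4 * m

namespace IsArcFamily

variable {m : ℕ} {g : ZMod (2 * m) → ℕ → Prop}

lemma add_half_add_half (s : ZMod (2 * m)) : s + (m : ℕ) + (m : ℕ) = s := by
  have h : ((2 * m : ℕ) : ZMod (2 * m)) = 0 := ZMod.natCast_self _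
  push_cast at h
  linear_combination h

lemma sub_half (s : ZMod (2 * m)) : s - (m : ℕ) = s + (m : ℕ) := by
  have h : ((2 * m : ℕ) : ZMod (2 * m)) = 0 := ZMod.natCast_self _
  push_cast at h
  linear_combination -h

lemma add_natCast_ne_self {n : ℕ} (s : ZMod n) {l : ℕ} (hl : 0 < l) (hln : l < n) :
    s + (l : ℕ) ≠ s := by
  intro h
  have h' : ((l : ℕ) : ZMod n) = 0 := by linear_combination h
  rw [ZMod.natCast_eq_zero_iff] at h'
  exact absurd (Nat.le_of_dvd hl h') (by omega)

lemma arcCount_reflect {n : ℕ} [NeZero n] {g : ZMod n → ℕ → Prop} :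
    arcCount (reflectArcs g) = arcCount g := by
  have h := sum_startLengths_eq_sum_endLengths (g := g) (fun _ => (1 : ℕ))
  simp only [Finset.sum_const, smul_eq_mul, mul_one] at h
  unfold arcCount
  rw [h, ← Equiv.sum_comp (Equiv.neg (ZMod n))]
  simp [startLengths_reflect]

lemma arcDeficit_eq [NeZero (2 * m)] :
    arcDeficit m g = ∑ s, pointLoss g s +
      2 * ((2 * m).choose (m + 2) : ℝ) * (4 * m - 2 - arcCount g) := by
  have h1 := sum_startLengths_eq_sum_endLengths (g := g)
    (fun k => ((2 * m).choose k : ℝ) - (2 * m).choose (m + 2))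
  have h2 : ∑ s, ∑ k ∈ startLengths g s, (((2 * m).choose k : ℝ) - (2 * m).choose (m + 2)) =
      arcWeight g - arcCount g * (2 * m).choose (m + 2) := by
    simp only [Finset.sum_sub_distrib, arcWeight, arcCount, Finset.sum_const, nsmul_eq_mul,
      Nat.cast_sum, Finset.sum_mul]
  have h3 : ∑ s, pointLoss g s = 2 * m * ((((2 * m).choose m : ℝ) - (2 * m).choose (m + 2)) +
      2 * chooseGap m) - 2 * (arcWeight g - arcCount g * (2 * m).choose (m + 2)) := by
    unfold pointLoss
    rw [Finset.sum_sub_distrib, Finset.sum_add_distrib (f := fun s => ∑ k ∈ startLengths g s, _),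
      ← h1, h2]
    simp
    ring
  rw [h3, arcDeficit, chooseGap]
  ring

lemma tight_or_le_pointLoss (hg : IsArcFamily g) (hm : 9 ≤ m) (s : ZMod (2 * m)) :
    (IsTight m (startLengths g s) (endLengths g s) ∧ pointLoss g s = 0) ∨
      chooseGap m ≤ pointLoss g s := by
  obtain ⟨f1, f2, f3, -, -⟩ := chooseGap_facts hm
  have := tight_or_sum_le (m := m)
    (v := fun k => ((2 * m).choose k : ℝ) - (2 * m).choose (m + 2))
    (d₀ := ((2 * m).choose m : ℝ) - (2 * m).choose (m + 2)) (d₁ := chooseGap m)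
    (by omega) rfl rfl
    (by simp only [chooseGap]; rw [choose_half_sub_one rfl (by omega)]) (sub_self _) f1.le f2
    (fun k hk => by
      have : ((2 * m).choose k : ℝ) ≤ (2 * m).choose (m + 2) := by
        exact_mod_cast choose_le_of_two_le_dist rfl hk
      simpa using this)
    (fun k hk => by
      have : ((2 * m).choose k : ℝ) ≤ (2 * m).choose (m + 3) := by
        exact_mod_cast choose_anti_of_half_le (m := m) rfl (by omega) hk
      linarith)
    (hg.card_startLengths_le s) (hg.card_endLengths_le s)
    (fun k hk l hl => hg.lt_add_of_start_end (hg.mem_startLengths.1 hk) (hg.mem_endLengths.1 hl))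
  unfold pointLoss
  rcases this with h | h
  · exact Or.inl ⟨h.1, by linarith [h.2]⟩
  · exact Or.inr (by linarith)

lemma pointLoss_nonneg (hg : IsArcFamily g) (hm : 9 ≤ m) (s : ZMod (2 * m)) :
    0 ≤ pointLoss g s := by
  rcases hg.tight_or_le_pointLoss hm s with h | h
  · exact h.2.ge
  · exact (chooseGap_facts hm).1.le.trans h

lemma not_halfTight_of_arcCount [NeZero (2 * m)] (hg : IsArcFamily g) (hm : 9 ≤ m)
    (hN : 4 * m ≤ arcCount g + 1) (s : ZMod (2 * m)) :
    ¬ HalfTight m (startLengths g s) (endLengths g s) := by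
  rintro ⟨h1, h2, -, -⟩
  have hs : 2 ≤ (startLengths g s).card := by
    have hsub : ({m, m + 1} : Finset ℕ) ⊆ startLengths g s := by
      simp [Finset.insert_subset_iff, h1, h2]
    simpa using Finset.card_le_card hsub
  have hbound : ∀ t, (startLengths g t).card + 2 * (2 * m - 1) ≥ arcCount g ∧
      ∀ u ≠ t, (startLengths g t).card + (startLengths g u).card + 2 * (2 * m - 2) ≥
        arcCount g := by
    intro t
    have ht := Finset.add_sum_erase Finset.univ (fun s => (startLengths g s).card)
      (Finset.mem_univ t)
    have hc : (Finset.univ.erase t).card = 2 * m - 1 := by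
      rw [Finset.card_erase_of_mem (Finset.mem_univ t), Finset.card_univ, ZMod.card]
    refine ⟨?_, fun u hu => ?_⟩
    · have := Finset.sum_le_card_nsmul (Finset.univ.erase t) (fun s => (startLengths g s).card) 2
        (fun x _ => hg.card_startLengths_le x)
      rw [hc, smul_eq_mul] at this
      rw [arcCount, ← ht]
      omega
    · have hu' := Finset.add_sum_erase (Finset.univ.erase t) (fun s => (startLengths g s).card)
        (Finset.mem_erase.2 ⟨hu, Finset.mem_univ u⟩)
      have := Finset.sum_le_card_nsmul ((Finset.univ.erase t).erase u)
        (fun s => (startLengths g s).card) 2 (fun x _ => hg.card_startLengths_le x)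
      rw [Finset.card_erase_of_mem (Finset.mem_erase.2 ⟨hu, Finset.mem_univ u⟩), hc,
        smul_eq_mul] at this
      rw [arcCount, ← ht, ← hu']
      omega
  rw [hg.mem_startLengths] at h1 h2
  by_cases ht : ∃ t, (startLengths g t).card < 2
  · obtain ⟨t, ht⟩ := ht
    refine hg.not_half_and_succ (m := m) rfl (by omega) (s := s) (t := t) ?_ ?_ ?_ h1 h2
    · rintro rfl; omega
    · intro u hu
      have := (hbound t).2 u hu
      omega
    · rw [← Finset.card_pos]
      have := (hbound t).1
      omega
  · push Not at ht
    refine hg.not_half_and_succ (m := m) rfl (by omega) (s := s) (t := s + (1 : ℕ)) ?_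
      (fun u _ => ht u) ?_ h1 h2
    · exact (add_natCast_ne_self s one_pos (by omega)).symm
    · rw [← Finset.card_pos]
      have := ht (s + (1 : ℕ))
      omega

lemma not_isTight_of_arcCount [NeZero (2 * m)] (hg : IsArcFamily g) (hm : 9 ≤ m)
    (hN : 4 * m ≤ arcCount g + 1) (s : ZMod (2 * m)) :
    ¬ IsTight m (startLengths g s) (endLengths g s) := by
  rintro (h | h)
  · exact hg.not_halfTight_of_arcCount hm hN s h
  · refine hg.reflect.not_halfTight_of_arcCount hm (by rwa [arcCount_reflect]) (-s) ?_
    rwa [startLengths_reflect, endLengths_reflect, neg_neg]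

lemma half_or_half_end_of_isTight (hg : IsArcFamily g) {s : ZMod (2 * m)}
    (h : IsTight m (startLengths g s) (endLengths g s)) :
    (g s m ∨ g (s + (m : ℕ)) m) ∧ g s (m + 1) ∧ g (s - ((m + 1 : ℕ) : ZMod (2 * m))) (m + 1) := by
  rcases h with h | h
  · exact ⟨Or.inl (hg.mem_startLengths.1 h.1), hg.mem_startLengths.1 h.2.1,
      hg.mem_endLengths.1 h.2.2.1⟩
  · have := hg.mem_endLengths.1 h.1
    rw [sub_half] at this
    exact ⟨Or.inr this, hg.mem_startLengths.1 h.2.2.1, hg.mem_endLengths.1 h.2.1⟩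

lemma eq_pair_of_halfTight {C D : Finset ℕ} (hC : C.card ≤ 2) (h : HalfTight m C D) :
    C = {m, m + 1} := by
  symm
  apply Finset.eq_of_subset_of_card_le
  · simp [Finset.insert_subset_iff, h.1, h.2.1]
  · rw [Finset.card_pair (by omega)]; exact hC

lemma length_of_isTight {C D : Finset ℕ} (hC : C.card ≤ 2) (hD : D.card ≤ 2)
    (h : IsTight m C D) {l : ℕ} (hl : l ∈ C ∨ l ∈ D) : l = m ∨ l = m + 1 ∨ l = m + 2 := by
  rcases h with h | h
  · rcases hl with hl | hl
    · rw [eq_pair_of_halfTight hC h] at hl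
      simp at hl; omega
    · have := h.2.2.2 l hl; omega
  · rcases hl with hl | hl
    · have := h.2.2.2 l hl; omega
    · rw [eq_pair_of_halfTight hD h] at hl
      simp at hl; omega

lemma isTight_of_forall_ne (hg : IsArcFamily g) (hm : 2 ≤ m) {s : ZMod (2 * m)}
    (h : ∀ u ≠ s, IsTight m (startLengths g u) (endLengths g u)) :
    IsTight m (startLengths g s) (endLengths g s) := by
  have hend : ∀ l, g (s - (l : ℕ)) l → l = m ∨ l = m + 1 ∨ l = m + 2 := by
    intro l hl
    have hne : s - (l : ℕ) ≠ s := by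
      intro hs
      have := add_natCast_ne_self s (hg.pos hl) (hg.lt hl)
      rw [← hs] at this
      exact this (by rw [sub_add_cancel]; exact hs.symm)
    exact length_of_isTight (hg.card_startLengths_le _) (hg.card_endLengths_le _) (h _ hne)
      (Or.inl (hg.mem_startLengths.2 hl))
  have hstart : ∀ l, g s l → l = m ∨ l = m + 1 ∨ l = m + 2 := by
    intro l hl
    refine length_of_isTight (hg.card_startLengths_le _) (hg.card_endLengths_le _)
      (h _ (add_natCast_ne_self s (hg.pos hl) (hg.lt hl))) (Or.inr ?_)
    rw [hg.mem_endLengths, add_sub_cancel_right]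
    exact hl
  have h1 : g s (m + 1) := by
    have := (hg.half_or_half_end_of_isTight
      (h _ (add_natCast_ne_self s (show 0 < m + 1 by omega) (by omega)))).2.2
    rwa [add_sub_cancel_right] at this
  have h2 : g (s - ((m + 1 : ℕ) : ZMod (2 * m))) (m + 1) := by
    refine (hg.half_or_half_end_of_isTight (h _ ?_)).2.1
    intro hs
    have := add_natCast_ne_self s (show 0 < m + 1 by omega) (show m + 1 < 2 * m by omega)
    rw [← hs] at this
    exact this (by rw [sub_add_cancel]; exact hs.symm)
  have hhalf := (hg.half_or_half_end_of_isTight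
    (h _ (add_natCast_ne_self s (show 0 < m by omega) (by omega)))).1
  rw [add_half_add_half] at hhalf
  rcases hhalf with h0 | h0
  · refine Or.inr ⟨hg.mem_endLengths.2 (by rwa [sub_half]), hg.mem_endLengths.2 h2,
      hg.mem_startLengths.2 h1, fun l hl => ?_⟩
    rw [hg.mem_startLengths] at hl
    have := hg.lt_add_of_start_end hl (l := m) (by rwa [sub_half])
    have := hstart l hl
    omega
  · refine Or.inl ⟨hg.mem_startLengths.2 h0, hg.mem_startLengths.2 h1,
      hg.mem_endLengths.2 h2, fun l hl => ?_⟩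
    rw [hg.mem_endLengths] at hl
    have := hg.lt_add_of_start_end h0 hl
    have := hend l hl
    omega

lemma arcDeficit_nonneg_of_isPerfect [NeZero (2 * m)] (hg : IsArcFamily g) (hm : 9 ≤ m)
    (h : IsPerfect m g) : 0 ≤ arcDeficit m g := by
  have hc : (arcCount g : ℝ) + 2 = 4 * m := by exact_mod_cast h.2
  rw [arcDeficit_eq, show (4 * m - 2 - arcCount g : ℝ) = 0 by linarith, mul_zero, add_zero]
  exact Finset.sum_nonneg fun s _ => hg.pointLoss_nonneg hm s

lemma gap_le_arcDeficit [NeZero (2 * m)] (hg : IsArcFamily g) (hm : 9 ≤ m)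
    (h : ¬ IsPerfect m g) : 2 * chooseGap m ≤ arcDeficit m g := by
  obtain ⟨f1, -, -, f4, f5⟩ := chooseGap_facts hm
  have hc : (0 : ℝ) ≤ (2 * m).choose (m + 2) := by positivity
  have hnn := fun s => hg.pointLoss_nonneg hm s
  rw [arcDeficit_eq]
  rcases lt_trichotomy (arcCount g + 2) (4 * m) with hN | hN | hN
  · have hN' : (arcCount g : ℝ) + 3 ≤ 4 * m := by exact_mod_cast hN
    have := Finset.sum_nonneg fun s (_ : s ∈ Finset.univ) => hnn s
    nlinarith
  · have hN' : (arcCount g : ℝ) + 2 = 4 * m := by exact_mod_cast hN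
    rw [show (4 * m - 2 - arcCount g : ℝ) = 0 by linarith, mul_zero, add_zero]
    have h' : ¬ ∀ s, IsTight m (startLengths g s) (endLengths g s) := fun h' => h ⟨h', hN⟩
    push Not at h'
    obtain ⟨s, hs⟩ := h'
    obtain ⟨t, hts, ht⟩ : ∃ t ≠ s, ¬ IsTight m (startLengths g t) (endLengths g t) := by
      by_contra! h'
      exact hs (hg.isTight_of_forall_ne (by omega) h')
    have e1 := (hg.tight_or_le_pointLoss hm s).resolve_left (fun h => hs h.1)
    have e2 := (hg.tight_or_le_pointLoss hm t).resolve_left (fun h => ht h.1)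
    have := Finset.sum_le_sum_of_subset_of_nonneg (Finset.subset_univ {s, t})
      (fun i _ _ => hnn i)
    rw [Finset.sum_pair hts.symm] at this
    linarith
  · have e := fun s => (hg.tight_or_le_pointLoss hm s).resolve_left
      (fun h => hg.not_isTight_of_arcCount hm (by omega) s h.1)
    have := Finset.sum_le_sum (fun s (_ : s ∈ Finset.univ) => e s)
    simp only [Finset.sum_const, Finset.card_univ, ZMod.card, nsmul_eq_mul] at this
    push_cast at this
    have hN2 : arcCount g ≤ 4 * m := by
      have := Finset.sum_le_card_nsmul Finset.univ (fun s => (startLengths g s).card) 2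
        (fun x _ => hg.card_startLengths_le x)
      rw [Finset.card_univ, ZMod.card, smul_eq_mul] at this
      unfold arcCount
      omega
    have hN3 : (arcCount g : ℝ) ≤ 4 * m := by exact_mod_cast hN2
    nlinarith

/-- The deficit is at least proportional to the number of points that start at most one arc. -/
lemma gap_mul_card_le_arcDeficit [NeZero (2 * m)] (hg : IsArcFamily g) (hm : 9 ≤ m)
    (h : ¬ IsPerfect m g) (K : Finset (ZMod (2 * m)))
    (hK : ∀ s ∈ K, (startLengths g s).card ≤ 1) :
    chooseGap m * K.card ≤ arcDeficit m g := by
  obtain ⟨f1, -, -, f4, f5⟩ := chooseGap_facts hm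
  rcases le_or_gt K.card 2 with hk | hk
  · have hk' : (K.card : ℝ) ≤ 2 := by exact_mod_cast hk
    have := hg.gap_le_arcDeficit hm h
    nlinarith
  · have hN : arcCount g + K.card ≤ 4 * m := by
      classical
      have h1 : ∀ s, (startLengths g s).card + (if s ∈ K then 1 else 0) ≤ 2 := by
        intro s
        split_ifs with hs
        · have := hK s hs; omega
        · exact hg.card_startLengths_le s
      have := Finset.sum_le_card_nsmul Finset.univ _ 2 (fun s _ => h1 s)
      rw [Finset.sum_add_distrib, Finset.card_univ, ZMod.card, smul_eq_mul,
        Finset.sum_ite_mem, Finset.univ_inter, Finset.sum_const, smul_eq_mul, mul_one] at this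
      unfold arcCount
      omega
    have hN' : (arcCount g : ℝ) + K.card ≤ 4 * m := by exact_mod_cast hN
    have hk' : (3 : ℝ) ≤ K.card := by exact_mod_cast hk
    rw [arcDeficit_eq]
    have := Finset.sum_nonneg fun s (_ : s ∈ Finset.univ) => hg.pointLoss_nonneg hm s
    have hc : (0 : ℝ) ≤ (2 * m).choose (m + 2) := by positivity
    have h2 : ((2 * m).choose (m + 2) : ℝ) * (K.card - 2) ≤
        (2 * m).choose (m + 2) * (4 * m - 2 - arcCount g) := by
      apply mul_le_mul_of_nonneg_left _ hc
      linarith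
    have h3 : 3 * chooseGap m * (K.card - 2) ≤ 2 * (2 * m).choose (m + 2) * (K.card - 2) := by
      apply mul_le_mul_of_nonneg_right f5
      linarith
    nlinarith

end IsArcFamily

/-- The selected arcs are those of the extremal configuration: the arcs of length `m` that contain
the point `p + (m - 1)`, all arcs of length `m + 1`, and the arcs of length `m + 2` that avoid that
point. -/
structure IsStandardAt (m : ℕ) (g : ZMod (2 * m) → ℕ → Prop) (p : ZMod (2 * m)) : Prop where
  half : ∀ j < m, g (p + (j : ℕ)) m
  not_half : ∀ j < m, ¬ g (p + (m : ℕ) + (j : ℕ)) m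
  succ : ∀ s, g s (m + 1)
  upper : ∀ j < m - 2, g (p + (m : ℕ) + (j : ℕ)) (m + 2)
  of_upper : ∀ s, g s (m + 2) → ∃ j < m - 2, s = p + (m : ℕ) + (j : ℕ)
  length : ∀ s k, g s k → k = m ∨ k = m + 1 ∨ k = m + 2

namespace IsArcFamily

variable {m : ℕ} {g : ZMod (2 * m) → ℕ → Prop}

open scoped Classical in
lemma card_half_and_card_upper [NeZero (2 * m)] (hg : IsArcFamily g) (h : IsPerfect m g) :
    (Finset.univ.filter fun s => ¬ g s m).card = m ∧
      (Finset.univ.filter fun s => g s (m + 2)).card + 2 = m := by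
  have htight := fun s => hg.half_or_half_end_of_isTight (h.1 s)
  have hstart : ∀ s, startLengths g s =
      ({m, m + 1, m + 2} : Finset ℕ).filter (g s) := by
    intro s
    ext l
    rw [hg.mem_startLengths, Finset.mem_filter]
    refine ⟨fun hl => ⟨?_, hl⟩, fun hl => hl.2⟩
    simpa using length_of_isTight (hg.card_startLengths_le _) (hg.card_endLengths_le _) (h.1 s)
      (Or.inl (hg.mem_startLengths.2 hl))
  have hcard : ∀ s, (startLengths g s).card =
      (if g s m then 1 else 0) + (1 + if g s (m + 2) then 1 else 0) := by
    intro s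
    rw [hstart, Finset.card_filter, Finset.sum_insert (by simp), Finset.sum_insert (by simp),
      Finset.sum_singleton, if_pos (htight s).2.1]
  have hN := h.2
  simp only [arcCount, hcard, Finset.sum_add_distrib, Finset.sum_const, Finset.card_univ,
    ZMod.card, smul_eq_mul, mul_one, ← Finset.card_filter] at hN
  have hanti : ∀ s, g s m ↔ ¬ g (s + (m : ℕ)) m := by
    intro s
    have := (htight s).1
    refine ⟨fun h1 h2 => ?_, fun h1 => this.resolve_right h1⟩
    have := hg.lt_add_of_start_end h1 (l := m) (by rwa [sub_half])
    omega
  have h1 : (Finset.univ.filter fun s => ¬ g s m).card =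
      (Finset.univ.filter fun s => g s m).card := by
    rw [Finset.card_filter, Finset.card_filter,
      ← Equiv.sum_comp (Equiv.addRight ((m : ℕ) : ZMod (2 * m)))]
    refine Finset.sum_congr rfl fun s _ => ?_
    by_cases hs : g (s + (m : ℕ)) m <;> simp [hanti s, hs]
  have h2 := Finset.card_filter_add_card_filter_not (s := Finset.univ) (fun s => g s m)
  rw [Finset.card_univ, ZMod.card] at h2
  omega

/-- A perfect family of arcs is standard. -/
lemma exists_isStandardAt [NeZero (2 * m)] (hg : IsArcFamily g) (hm : 3 ≤ m)
    (h : IsPerfect m g) : ∃ p, IsStandardAt m g p := by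
  classical
  have htight := fun s => hg.half_or_half_end_of_isTight (h.1 s)
  obtain ⟨hI, hJ⟩ := hg.card_half_and_card_upper h
  have hanti : ∀ s, g s m → ¬ g (s + (m : ℕ)) m := by
    intro s h1 h2
    have := hg.lt_add_of_start_end h1 (l := m) (by rwa [sub_half])
    omega
  have chain : ∀ s, g s (m + 2) → ∀ i ≤ 2, ¬ g (s + (i : ℕ)) m := by
    intro s hs i hi hi'
    rcases (by omega : i = 0 ∨ i = 1 ∨ i = 2) with rfl | rfl | rfl
    · exact hg.sperner (i := 0) (j := 0) hs (htight _).2.1 (r := m) (by simpa using hi')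
        (by omega) (by omega) (by omega) (by omega)
    · exact hg.sperner (i := 0) (j := 1) hs (htight _).2.1 (r := m) (by simpa using hi')
        (by omega) (by omega) (by omega) (by omega)
    · refine hg.sperner (i := 1) (j := 1) hs (htight _).2.1 (r := m) ?_
        (by omega) (by omega) (by omega) (by omega)
      convert hi' using 1
      push_cast; ring
  set R := (Finset.univ.filter fun s => ¬ g s m) \ (Finset.univ.filter fun s => g s (m + 2))
    with hR
  have hRcard : R.card = 2 := by
    rw [hR, Finset.card_sdiff_of_subset, hI]
    · omega
    · intro s hs
      simp only [Finset.mem_filter, Finset.mem_univ, true_and] at hs ⊢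
      simpa using chain s hs 0 (by omega)
  have memR : ∀ s, s ∈ R ↔ ¬ g s m ∧ ¬ g s (m + 2) := by
    intro s; simp [hR]
  obtain ⟨j, hj⟩ : ∃ j, g j (m + 2) := by
    have : 0 < (Finset.univ.filter fun s => g s (m + 2)).card := by omega
    obtain ⟨j, hj⟩ := Finset.card_pos.1 this
    exact ⟨j, by simpa using hj⟩
  have hex : ∃ t : ℕ, g (j + (t : ℕ)) m := by
    rcases (htight j).1 with h0 | h0
    · exact ⟨0, by simpa using h0⟩
    · exact ⟨m, h0⟩
  have ht := Nat.find_spec hex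
  have hmin := fun i (hi : i < Nat.find hex) => Nat.find_min hex hi
  set t := Nat.find hex
  have ht3 : 3 ≤ t := by
    by_contra! h3
    exact chain j hj t (by omega) ht
  have hcast1 : j + (t : ℕ) - 1 = j + ((t - 1 : ℕ) : ZMod (2 * m)) := by
    rw [Nat.cast_sub (by omega)]; push_cast; ring
  have hcast2 : j + (t : ℕ) - 2 = j + ((t - 2 : ℕ) : ZMod (2 * m)) := by
    rw [Nat.cast_sub (by omega)]; push_cast; ring
  set p := j + (t : ℕ) with hp
  have hp1 : ¬ g (p - 1) m := by rw [hcast1]; exact hmin _ (by omega)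
  have hp2 : ¬ g (p - 2) m := by rw [hcast2]; exact hmin _ (by omega)
  have hR1 : p - 1 ∈ R := by
    rw [memR]
    refine ⟨hp1, fun h1 => chain _ h1 1 (by omega) ?_⟩
    simpa using ht
  have hR2 : p - 2 ∈ R := by
    rw [memR]
    refine ⟨hp2, fun h1 => chain _ h1 2 (by omega) ?_⟩
    simpa using ht
  have hne : p - 1 ≠ p - 2 := by
    have := add_natCast_ne_self (n := 2 * m) (p - 2) one_pos (by omega)
    intro h'
    apply this
    rw [← h']
    push_cast
    linear_combination h'
  have hReq : R = {p - 1, p - 2} := by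
    symm
    apply Finset.eq_of_subset_of_card_le
    · simp [Finset.insert_subset_iff, hR1, hR2]
    · rw [Finset.card_pair hne, hRcard]
  have hpred : ∀ s, s ≠ p → g s m → g (s - 1) m := by
    intro s hs h1
    by_contra h2
    have h3 : s - 1 ∉ R := by
      rw [hReq]
      simp only [Finset.mem_insert, Finset.mem_singleton, not_or]
      refine ⟨fun h => hs (by linear_combination h), fun h => hp1 ?_⟩
      convert h1 using 1
      linear_combination -h
    rw [memR] at h3
    have h4 : g (s - 1) (m + 2) := by
      by_contra h5; exact h3 ⟨h2, h5⟩
    exact chain _ h4 1 (by omega) (by simpa using h1)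
  have hlast : g (p + ((m - 1 : ℕ) : ZMod (2 * m))) m := by
    have := (htight (p - 1)).1.resolve_left hp1
    rw [Nat.cast_sub (by omega)]
    convert this using 1
    push_cast; ring
  have hdesc : ∀ i < m, g (p + ((m - 1 - i : ℕ) : ZMod (2 * m))) m := by
    intro i
    induction i with
    | zero => intro _; exact hlast
    | succ i ih =>
      intro hi
      have h1 := hpred _ (add_natCast_ne_self (n := 2 * m) p (show 0 < m - 1 - i by omega)
        (by omega)) (ih (by omega))
      convert h1 using 1
      rw [show m - 1 - i = m - 1 - (i + 1) + 1 by omega]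
      push_cast; ring
  have hhalf : ∀ j < m, g (p + (j : ℕ)) m := by
    intro j hj
    have := hdesc (m - 1 - j) (by omega)
    rwa [show m - 1 - (m - 1 - j) = j by omega] at this
  have hnot : ∀ j < m, ¬ g (p + (m : ℕ) + (j : ℕ)) m := by
    intro j hj
    have := hanti _ (hhalf j hj)
    rwa [add_right_comm] at this
  have hz : ((2 * m : ℕ) : ZMod (2 * m)) = 0 := ZMod.natCast_self _
  push_cast at hz
  have hform : ∀ s, ∃ i < 2 * m, s = p + (i : ℕ) := fun s =>
    ⟨(s - p).val, ZMod.val_lt _, by rw [ZMod.natCast_zmod_val]; ring⟩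
  have hR1' : p - 1 = p + (m : ℕ) + ((m - 1 : ℕ) : ZMod (2 * m)) := by
    rw [Nat.cast_sub (by omega)]; push_cast; linear_combination -hz
  have hR2' : p - 2 = p + (m : ℕ) + ((m - 2 : ℕ) : ZMod (2 * m)) := by
    rw [Nat.cast_sub (by omega)]; push_cast; linear_combination -hz
  have hinj : ∀ a b : ℕ, a < m → b < m →
      p + (m : ℕ) + (a : ℕ) = p + (m : ℕ) + (b : ℕ) → a = b := by
    intro a b ha hb hab
    have h1 := congrArg ZMod.val (add_left_cancel hab)
    rwa [ZMod.val_natCast_of_lt (by omega), ZMod.val_natCast_of_lt (by omega)] at h1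
  refine ⟨p, hhalf, hnot, fun s => (htight s).2.1, fun i hi => ?_, fun s hs => ?_,
    fun s k hk => ?_⟩
  · by_contra h1
    have h2 := (memR _).2 ⟨hnot i (by omega), h1⟩
    rw [hReq, hR1', hR2'] at h2
    simp only [Finset.mem_insert, Finset.mem_singleton] at h2
    rcases h2 with h2 | h2
    · have := hinj _ _ (by omega) (by omega) h2; omega
    · have := hinj _ _ (by omega) (by omega) h2; omega
  · obtain ⟨i, hi, rfl⟩ := hform s
    have hi1 : m ≤ i := by
      by_contra! h1
      exact chain _ hs 0 (by omega) (by simpa using hhalf i h1)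
    refine ⟨i - m, ?_, by rw [Nat.cast_sub hi1]; ring⟩
    have hi2 : p + (i : ZMod (2 * m)) = p + (m : ℕ) + ((i - m : ℕ) : ZMod (2 * m)) := by
      rw [Nat.cast_sub hi1]; ring
    by_contra! h1
    have h3 : p + (i : ZMod (2 * m)) ∈ R := by
      rw [hReq, hR1', hR2', hi2]
      rcases (by omega : i - m = m - 1 ∨ i - m = m - 2) with h | h <;> simp [h]
    exact ((memR _).1 h3).2 hs
  · exact length_of_isTight (hg.card_startLengths_le _) (hg.card_endLengths_le _) (h.1 s)
      (Or.inl (hg.mem_startLengths.2 hk))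

end IsArcFamily

lemma exists_equiv_comp_eq {α β ι : Type*} [Fintype α] [Fintype β] (f : β → ι) (h : α → ι) [DecidableEq ι]
    (hfib : ∀ i, Fintype.card {b // f b = i} = Fintype.card {a // h a = i}) :
    ∃ σ : β ≃ α, h ∘ σ = f := by
  refine ⟨Equiv.ofFiberEquiv (fun i => Fintype.equivOfCardEq (hfib i)), ?_⟩
  funext b
  exact Equiv.ofFiberEquiv_map _ b

lemma card_equiv_comp_eq {α β ι : Type*} [Fintype α] [DecidableEq α] [Fintype β] [DecidableEq β] [Fintype ι] [DecidableEq ι]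
    (f : β → ι) (h : α → ι)
    (hfib : ∀ i, Fintype.card {b // f b = i} = Fintype.card {a // h a = i}) :
    (Finset.univ.filter fun σ : β ≃ α => h ∘ σ = f).card =
      ∏ i, (Fintype.card {a // h a = i}).factorial := by
  obtain ⟨τ, hτ⟩ := exists_equiv_comp_eq f h hfib
  rw [← DomMulAct.stabilizer_card h, ← Fintype.card_subtype]
  refine Fintype.card_congr ⟨fun σ => ⟨τ.symm.trans σ.1, ?_⟩, fun π => ⟨τ.trans π.1, ?_⟩, ?_, ?_⟩
  · funext a
    have h1 := congrFun σ.2 (τ.symm a)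
    have h2 := congrFun hτ (τ.symm a)
    simp only [Function.comp_apply, Equiv.apply_symm_apply] at h1 h2
    simp only [Function.comp_apply, Equiv.trans_apply]
    rw [h1, ← h2]
  · funext b
    have h1 := congrFun π.2 (τ b)
    have h2 := congrFun hτ b
    simp only [Function.comp_apply] at h1 h2
    simp only [Function.comp_apply, Equiv.trans_apply]
    rw [h1, ← h2]
  · intro σ; ext; simp
  · intro π; ext; simp

lemma card_flag_fiber {γ : Type*} [Fintype γ] [DecidableEq γ] {P Q R : Finset γ} (hPQ : P ⊆ Q)
    (hQR : Q ⊆ R) (b : Bool × Bool × Bool) :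
    Fintype.card {x // (decide (x ∈ P), decide (x ∈ Q), decide (x ∈ R)) = b} =
      match b with
      | (true, true, true) => P.card
      | (false, true, true) => Q.card - P.card
      | (false, false, true) => R.card - Q.card
      | (false, false, false) => Fintype.card γ - R.card
      | _ => 0 := by
  rw [Fintype.card_subtype]
  have key : ∀ T : Finset γ, (∀ x, (decide (x ∈ P), decide (x ∈ Q), decide (x ∈ R)) = b ↔
      x ∈ T) → (Finset.univ.filter fun x =>
        (decide (x ∈ P), decide (x ∈ Q), decide (x ∈ R)) = b).card = T.card := by
    intro T hT
    congr 1; ext x; simp [← hT x]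
  have hPQ' := fun x => @hPQ x
  have hQR' := fun x => @hQR x
  rcases b with ⟨_ | _, _ | _, _ | _⟩
  · rw [key Rᶜ, Finset.card_compl]
    intro x; have := hPQ' x; have := hQR' x; simp; tauto
  · rw [key (R \ Q), Finset.card_sdiff_of_subset hQR]
    intro x; have := hPQ' x; have := hQR' x; simp; tauto
  · rw [key ∅, Finset.card_empty]
    intro x; have := hPQ' x; have := hQR' x; simp; tauto
  · rw [key (Q \ P), Finset.card_sdiff_of_subset hPQ]
    intro x; have := hPQ' x; have := hQR' x; simp; tauto
  · rw [key ∅, Finset.card_empty]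
    intro x; have := hPQ' x; have := hQR' x; simp; tauto
  · rw [key ∅, Finset.card_empty]
    intro x; have := hPQ' x; have := hQR' x; simp; tauto
  · rw [key ∅, Finset.card_empty]
    intro x; have := hPQ' x; have := hQR' x; simp; tauto
  · rw [key P]
    intro x; have := hPQ' x; have := hQR' x; simp; tauto

/-- The number of bijections that map a given flag of three sets to another one. -/
lemma card_equiv_map_three {α β : Type*} [Fintype α] [DecidableEq α] [Fintype β] [DecidableEq β]
    (hβ : Fintype.card β = Fintype.card α) {I J K : Finset β} {A M D : Finset α}
    (hIJ : I ⊆ J) (hJK : J ⊆ K) (hAM : A ⊆ M) (hMD : M ⊆ D)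
    (hI : I.card = A.card) (hJ : J.card = M.card) (hK : K.card = D.card) :
    (Finset.univ.filter fun σ : β ≃ α => I.map σ.toEmbedding = A ∧ J.map σ.toEmbedding = M ∧
      K.map σ.toEmbedding = D).card =
    A.card.factorial * (M.card - A.card).factorial * (D.card - M.card).factorial *
      (Fintype.card α - D.card).factorial := by
  have hmap : ∀ (σ : β ≃ α) (S : Finset β) (T : Finset α),
      S.map σ.toEmbedding = T ↔ ∀ x, σ x ∈ T ↔ x ∈ S := by
    intro σ S T
    constructor
    · rintro rfl x; simp
    · intro h; ext y
      obtain ⟨x, rfl⟩ := σ.surjective y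
      simp [h]
  have h := card_equiv_comp_eq
    (f := fun x : β => (decide (x ∈ I), decide (x ∈ J), decide (x ∈ K)))
    (h := fun x : α => (decide (x ∈ A), decide (x ∈ M), decide (x ∈ D))) (by
      intro b
      rw [card_flag_fiber hIJ hJK, card_flag_fiber hAM hMD, hI, hJ, hK, hβ])
  simp only [card_flag_fiber hAM hMD] at h
  simp only [Fintype.prod_prod_type, Fintype.prod_bool, Nat.factorial_zero, mul_one] at h
  rw [mul_assoc, mul_assoc]
  rw [← h]
  congr 1
  ext σ
  simp only [Finset.mem_filter, Finset.mem_univ, true_and, hmap, funext_iff, Function.comp_apply,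
    Prod.mk.injEq, decide_eq_decide]
  exact ⟨fun h x => ⟨h.1 x, h.2.1 x, h.2.2 x⟩,
    fun h => ⟨fun x => (h x).1, fun x => (h x).2.1, fun x => (h x).2.2⟩⟩

section Arcs

variable {n : ℕ} [NeZero n] {α : Type*}

/-- The `k` consecutive points of `ZMod n` starting at `s`. -/
def cyclicInterval (s : ZMod n) (k : ℕ) : Finset (ZMod n) :=
  Finset.univ.filter fun x => (x - s).val < k

lemma mem_cyclicInterval {s x : ZMod n} {k : ℕ} :
    x ∈ cyclicInterval s k ↔ (x - s).val < k := by
  simp [cyclicInterval]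

lemma add_mem_cyclicInterval {s : ZMod n} {i k : ℕ} (hi : i < n) :
    s + (i : ZMod n) ∈ cyclicInterval s k ↔ i < k := by
  rw [mem_cyclicInterval, add_sub_cancel_left, ZMod.val_natCast_of_lt hi]

lemma exists_eq_add_natCast (s x : ZMod n) : ∃ i < n, x = s + (i : ZMod n) :=
  ⟨(x - s).val, ZMod.val_lt _, by rw [ZMod.natCast_zmod_val]; ring⟩

lemma card_cyclicInterval (s : ZMod n) {k : ℕ} (hk : k ≤ n) : (cyclicInterval s k).card = k := by
  have : cyclicInterval s k = (Finset.range k).image (fun i : ℕ => s + (i : ZMod n)) := by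
    ext x
    rw [Finset.mem_image]
    constructor
    · intro hx
      obtain ⟨i, hi, rfl⟩ := exists_eq_add_natCast s x
      rw [add_mem_cyclicInterval hi] at hx
      exact ⟨i, Finset.mem_range.2 hx, rfl⟩
    · rintro ⟨i, hi, rfl⟩
      rw [Finset.mem_range] at hi
      rwa [add_mem_cyclicInterval (by omega)]
  rw [this, Finset.card_image_of_injOn, Finset.card_range]
  intro a ha b hb hab
  simp only [Finset.coe_range, Set.mem_Iio] at ha hb
  have h1 := congrArg ZMod.val (add_left_cancel hab)
  rwa [ZMod.val_natCast_of_lt (by omega), ZMod.val_natCast_of_lt (by omega)] at h1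

lemma cyclicInterval_subset (s : ZMod n) {i k l : ℕ} (h : i + k ≤ l) (hl : l ≤ n) :
    cyclicInterval (s + (i : ZMod n)) k ⊆ cyclicInterval s l := by
  intro x hx
  obtain ⟨j, hj, rfl⟩ := exists_eq_add_natCast (s + (i : ZMod n)) x
  rw [add_mem_cyclicInterval hj] at hx
  rw [add_assoc, ← Nat.cast_add, add_mem_cyclicInterval (by omega)]
  omega

lemma cyclicInterval_disjoint (s : ZMod n) {i k l : ℕ} (h : k ≤ i) (hl : i + l ≤ n) :
    Disjoint (cyclicInterval s k) (cyclicInterval (s + (i : ZMod n)) l) := by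
  rw [Finset.disjoint_left]
  intro x hx hx'
  obtain ⟨j, hj, rfl⟩ := exists_eq_add_natCast (s + (i : ZMod n)) x
  rw [add_mem_cyclicInterval hj] at hx'
  rw [add_assoc, ← Nat.cast_add, add_mem_cyclicInterval (by omega)] at hx
  omega

/-- The image under `σ` of the `k` consecutive points starting at `s`. -/
def arc (σ : ZMod n ≃ α) (s : ZMod n) (k : ℕ) : Finset α :=
  (cyclicInterval s k).map σ.toEmbedding

variable {σ : ZMod n ≃ α}

lemma apply_mem_arc {s x : ZMod n} {k : ℕ} : σ x ∈ arc σ s k ↔ x ∈ cyclicInterval s k := by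
  simp [arc]

lemma card_arc (σ : ZMod n ≃ α) (s : ZMod n) {k : ℕ} (hk : k ≤ n) : (arc σ s k).card = k := by
  rw [arc, Finset.card_map, card_cyclicInterval s hk]

lemma arc_subset (σ : ZMod n ≃ α) (s : ZMod n) {i k l : ℕ} (h : i + k ≤ l) (hl : l ≤ n) :
    arc σ (s + (i : ZMod n)) k ⊆ arc σ s l :=
  Finset.map_subset_map.2 (cyclicInterval_subset s h hl)

lemma arc_ssubset (σ : ZMod n ≃ α) (s : ZMod n) {i k l : ℕ} (h : i + k ≤ l) (hkl : k < l)
    (hl : l ≤ n) : arc σ (s + (i : ZMod n)) k ⊂ arc σ s l := by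
  refine Finset.ssubset_iff_subset_ne.2 ⟨arc_subset σ s h hl, fun h' => ?_⟩
  have := congrArg Finset.card h'
  rw [card_arc _ _ (by omega), card_arc _ _ hl] at this
  omega

lemma arc_disjoint (σ : ZMod n ≃ α) (s : ZMod n) {i k l : ℕ} (h : k ≤ i) (hl : i + l ≤ n) :
    Disjoint (arc σ s k) (arc σ (s + (i : ZMod n)) l) :=
  (Finset.disjoint_map _).2 (cyclicInterval_disjoint s h hl)

end Arcs

section Chains

variable {α : Type*} {F : Finset (Finset α)}

lemma ButterflyFree.eq_of_ssubset_of_ssubset (hB : ButterflyFree F) {A M D D' : Finset α}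
    (hA : A ∈ F) (hM : M ∈ F) (hD : D ∈ F) (hD' : D' ∈ F) (hAM : A ⊂ M) (hMD : M ⊂ D)
    (hMD' : M ⊂ D') : D = D' := by
  by_contra h
  exact hB ⟨A, M, D, D', hA, hM, hD, hD', hAM.ne, (hAM.trans hMD).ne, (hAM.trans hMD').ne,
    hMD.ne, hMD'.ne, h, (hAM.trans hMD).subset, (hAM.trans hMD').subset, hMD.subset, hMD'.subset⟩

lemma ButterflyFree.eq_of_ssubset_of_ssubset' (hB : ButterflyFree F) {A A' M D : Finset α}
    (hA : A ∈ F) (hA' : A' ∈ F) (hM : M ∈ F) (hD : D ∈ F) (hAM : A ⊂ M) (hAM' : A' ⊂ M)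
    (hMD : M ⊂ D) : A = A' := by
  by_contra h
  exact hB ⟨A, A', M, D, hA, hA', hM, hD, h, hAM.ne, (hAM.trans hMD).ne, hAM'.ne,
    (hAM'.trans hMD).ne, hMD.ne, hAM.subset, (hAM.trans hMD).subset, hAM'.subset,
    (hAM'.trans hMD).subset⟩

variable [DecidableEq α]

/-- The three-element chains `A ⊂ M ⊂ D` in `F`. -/
def chainTriples (F : Finset (Finset α)) : Finset (Finset α × Finset α × Finset α) :=
  (F ×ˢ F ×ˢ F).filter fun t => t.1 ⊂ t.2.1 ∧ t.2.1 ⊂ t.2.2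

lemma mem_chainTriples {A M D : Finset α} :
    (A, M, D) ∈ chainTriples F ↔ A ∈ F ∧ M ∈ F ∧ D ∈ F ∧ A ⊂ M ∧ M ⊂ D := by
  simp [chainTriples, Finset.mem_product, and_assoc]

lemma ButterflyFree.chainTriples_injOn (hB : ButterflyFree F) {A M D A' D' : Finset α}
    (h : (A, M, D) ∈ chainTriples F) (h' : (A', M, D') ∈ chainTriples F) : A = A' ∧ D = D' := by
  rw [mem_chainTriples] at h h'
  exact ⟨hB.eq_of_ssubset_of_ssubset' h.1 h'.1 h.2.1 h.2.2.1 h.2.2.2.1 h'.2.2.2.1 h.2.2.2.2,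
    hB.eq_of_ssubset_of_ssubset h.1 h.2.1 h.2.2.1 h'.2.2.1 h.2.2.2.1 h.2.2.2.2 h'.2.2.2.2⟩

end Chains

section Selection

variable {n : ℕ} [NeZero n] {α : Type*}

/-- The bottom of the chain `t` is an arc inside the arc that starts at `s` and has the size of the
middle of `t`. -/
def HasLowerArc (σ : ZMod n ≃ α) (s : ZMod n) (t : Finset α × Finset α × Finset α) : Prop :=
  ∃ i : ℕ, i + t.1.card ≤ t.2.1.card ∧ arc σ (s + (i : ZMod n)) t.1.card = t.1

/-- The top of the chain `t` is an arc around the arc that starts at `s` and has the size of the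
middle of `t`. -/
def HasUpperArc (σ : ZMod n ≃ α) (s : ZMod n) (t : Finset α × Finset α × Finset α) : Prop :=
  ∃ i : ℕ, i + t.2.1.card ≤ t.2.2.card ∧ arc σ (s - (i : ZMod n)) t.2.2.card = t.2.2

variable [DecidableEq α] {F : Finset (Finset α)}

/-- The middle of the chain `t` is the arc starting at `s`, and the other two members are arcs. -/
def IsArcChain (σ : ZMod n ≃ α) (s : ZMod n) (t : Finset α × Finset α × Finset α) : Prop :=
  arc σ s t.2.1.card = t.2.1 ∧ HasLowerArc σ s t ∧ HasUpperArc σ s t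

/-- The arcs of `σ` that belong to `F` and are not the middle of a chain of three arcs. -/
def selectedArcs (F : Finset (Finset α)) (σ : ZMod n ≃ α) (s : ZMod n) (k : ℕ) : Prop :=
  arc σ s k ∈ F ∧ 0 < k ∧ k < n ∧
    ∀ t ∈ chainTriples F, t.2.1 = arc σ s k → ¬ IsArcChain σ s t

lemma isArcFamily_selectedArcs (hF : Intersecting F) (σ : ZMod n ≃ α) :
    IsArcFamily (selectedArcs F σ) where
  pos h := h.2.1
  lt h := h.2.2.1
  inter {s k i l} h₁ h₂ h₃ h₄ := by
    have h := hF _ h₁.1 _ h₂.1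
    rw [Finset.disjoint_iff_inter_eq_empty.1 (arc_disjoint σ s h₃ h₄)] at h
    exact Finset.not_nonempty_empty h
  sperner {s l i k j r} h₁ h₂ h₃ h₄ h₅ h₆ h₇ := by
    have hl := h₁.2.2.1
    refine h₂.2.2.2 (arc σ (s + (i : ZMod n) + (j : ZMod n)) r, arc σ (s + (i : ZMod n)) k,
      arc σ s l) ?_ rfl ⟨?_, ⟨j, ?_, ?_⟩, ⟨i, ?_, ?_⟩⟩
    · rw [mem_chainTriples]
      exact ⟨h₃.1, h₂.1, h₁.1, arc_ssubset σ _ h₆ h₇ (by omega), arc_ssubset σ _ h₄ h₅ hl.le⟩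
    all_goals simp only [card_arc σ _ hl.le, card_arc σ _ (show k ≤ n by omega),
      card_arc σ _ (show r ≤ n by omega)]
    · exact h₆
    · exact h₄
    · rw [add_sub_cancel_right]

open scoped Classical in
/-- The points at which the middle of some chain in `F` starts as an arc, such that neither of the
other two members of that chain is an arc. -/
noncomputable def isolatedPoints (F : Finset (Finset α)) (σ : ZMod n ≃ α) : Finset (ZMod n) :=
  Finset.univ.filter fun s => ∃ t ∈ chainTriples F, arc σ s t.2.1.card = t.2.1 ∧
    ¬ HasLowerArc σ s t ∧ ¬ HasUpperArc σ s t

lemma mem_isolatedPoints {σ : ZMod n ≃ α} {s : ZMod n} :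
    s ∈ isolatedPoints F σ ↔ ∃ t ∈ chainTriples F, arc σ s t.2.1.card = t.2.1 ∧
      ¬ HasLowerArc σ s t ∧ ¬ HasUpperArc σ s t := by
  simp [isolatedPoints]

lemma not_mem_of_not_hasLowerArc (hB : ButterflyFree F) {σ : ZMod n ≃ α} {s : ZMod n}
    {A M D : Finset α} (ht : (A, M, D) ∈ chainTriples F) (hM : arc σ s M.card = M)
    (hMn : M.card ≤ n) (h : ¬ HasLowerArc σ s (A, M, D)) {i k : ℕ} (hik : i + k ≤ M.card)
    (hk : k < M.card) : arc σ (s + (i : ZMod n)) k ∉ F := by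
  intro hF
  have ht' := ht
  rw [mem_chainTriples] at ht
  have hsub := arc_ssubset σ s hik hk hMn
  rw [hM] at hsub
  have heq : A = arc σ (s + (i : ZMod n)) k :=
    (hB.chainTriples_injOn ht' (mem_chainTriples.2 ⟨hF, ht.2.1, ht.2.2.1, hsub, ht.2.2.2.2⟩)).1
  have hc : A.card = k := by rw [heq, card_arc σ _ (by omega)]
  exact h ⟨i, by simpa [hc] using hik, by simp only [hc]; exact heq.symm⟩

lemma not_mem_of_not_hasUpperArc (hB : ButterflyFree F) {σ : ZMod n ≃ α} {s : ZMod n}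
    {A M D : Finset α} (ht : (A, M, D) ∈ chainTriples F) (hM : arc σ s M.card = M)
    (h : ¬ HasUpperArc σ s (A, M, D)) {i k : ℕ} (hik : i + M.card ≤ k)
    (hk : M.card < k) (hkn : k ≤ n) : arc σ (s - (i : ZMod n)) k ∉ F := by
  intro hF
  have ht' := ht
  rw [mem_chainTriples] at ht
  have hsub := arc_ssubset σ (s - (i : ZMod n)) hik hk hkn
  rw [sub_add_cancel, hM] at hsub
  have heq : D = arc σ (s - (i : ZMod n)) k :=
    (hB.chainTriples_injOn ht' (mem_chainTriples.2 ⟨ht.1, ht.2.1, hF, ht.2.2.2.1, hsub⟩)).2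
  have hc : D.card = k := by rw [heq, card_arc σ _ (by omega)]
  exact h ⟨i, by simpa [hc] using hik, by simp only [hc]; exact heq.symm⟩

lemma eq_of_arc_mem (hB : ButterflyFree F) {σ : ZMod n ≃ α} {s : ZMod n}
    {A M D : Finset α} (ht : (A, M, D) ∈ chainTriples F) (hM : arc σ s M.card = M)
    (hMn : M.card ≤ n) (h : ¬ HasLowerArc σ s (A, M, D)) (h' : ¬ HasUpperArc σ s (A, M, D))
    {k : ℕ} (hk : k ≤ n) (hF : arc σ s k ∈ F) : k = M.card := by
  rcases lt_trichotomy k M.card with hlt | heq | hlt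
  · refine absurd ?_ (not_mem_of_not_hasLowerArc hB ht hM hMn h (i := 0) (k := k) (by omega) hlt)
    simpa using hF
  · exact heq
  · refine absurd ?_ (not_mem_of_not_hasUpperArc hB ht hM h' (i := 0) (k := k) (by omega) hlt hk)
    simpa using hF

lemma card_startLengths_of_mem_isolatedPoints (hF : Intersecting F) (hB : ButterflyFree F)
    (hsize : ∀ S ∈ F, S.card ≤ n) {σ : ZMod n ≃ α} {s : ZMod n}
    (hs : s ∈ isolatedPoints F σ) : (startLengths (selectedArcs F σ) s).card ≤ 1 := by
  obtain ⟨⟨A, M, D⟩, ht, hM, h, h'⟩ := mem_isolatedPoints.1 hs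
  have hMn := hsize M (mem_chainTriples.1 ht).2.1
  have key : ∀ k ∈ startLengths (selectedArcs F σ) s, k = M.card := by
    intro k hk
    rw [(isArcFamily_selectedArcs hF σ).mem_startLengths] at hk
    exact eq_of_arc_mem hB ht hM hMn h h' hk.2.2.1.le hk.1
  exact Finset.card_le_one.2 fun a ha b hb => (key a ha).trans (key b hb).symm

open scoped Classical in
lemma sum_isolated_le_card (hB : ButterflyFree F) (hsize : ∀ S ∈ F, S.card ≤ n)
    (σ : ZMod n ≃ α) :
    ∑ s : ZMod n, ((chainTriples F).filter fun t : Finset α × Finset α × Finset α =>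
      arc σ s t.2.1.card = t.2.1 ∧
      ¬ HasLowerArc σ s t ∧ ¬ HasUpperArc σ s t).card ≤ (isolatedPoints F σ).card := by
  rw [isolatedPoints, Finset.card_filter]
  refine Finset.sum_le_sum fun s _ => ?_
  split_ifs with h
  · rw [Finset.card_le_one]
    rintro ⟨A, M, D⟩ h1 ⟨A', M', D'⟩ h2
    rw [Finset.mem_filter] at h1 h2
    have hc : M'.card = M.card := by
      refine eq_of_arc_mem hB h1.1 h1.2.1 (hsize M (mem_chainTriples.1 h1.1).2.1)
        h1.2.2.1 h1.2.2.2 (hsize M' (mem_chainTriples.1 h2.1).2.1) ?_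
      have := h2.2.1
      dsimp only at this
      rw [this]
      exact (mem_chainTriples.1 h2.1).2.1
    have hM : M' = M := by
      have e1 := h1.2.1
      have e2 := h2.2.1
      dsimp only at e1 e2
      rw [← e1, ← e2, hc]
    subst hM
    obtain ⟨rfl, rfl⟩ := hB.chainTriples_injOn h1.1 h2.1
    rfl
  · rw [Nat.le_zero, Finset.card_eq_zero, Finset.filter_eq_empty_iff]
    intro t ht h'
    exact h ⟨t, ht, h'⟩

end Selection

section Perfect

variable {m : ℕ} [NeZero (2 * m)] {α : Type*} [DecidableEq α] {F : Finset (Finset α)}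

lemma isolatedPoints_eq_empty (hB : ButterflyFree F)
    (hm : 3 ≤ m) (hsize : ∀ S ∈ F, S.card ≤ 2 * m) {σ : ZMod (2 * m) ≃ α} {p : ZMod (2 * m)}
    (hp : IsStandardAt m (selectedArcs F σ) p) : isolatedPoints F σ = ∅ := by
  rw [Finset.eq_empty_iff_forall_notMem]
  intro s hs
  obtain ⟨⟨A, M, D⟩, ht, hM, h, h'⟩ := mem_isolatedPoints.1 hs
  dsimp only at hM
  have hMF := (mem_chainTriples.1 ht).2.1
  have hMn := hsize M hMF
  have hsucc := eq_of_arc_mem hB ht hM hMn h h' (k := m + 1) (by omega) (hp.succ s).1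
  have hM1 : M.card = m + 1 := hsucc.symm
  have e1 : ∀ s, ∃ i < 2 * m, s = p + (i : ZMod (2 * m)) := exists_eq_add_natCast p
  have f1 := not_mem_of_not_hasLowerArc hB ht hM hMn h (i := 0) (k := m) (by omega) (by omega)
  have f2 := not_mem_of_not_hasLowerArc hB ht hM hMn h (i := 1) (k := m) (by omega) (by omega)
  have f3 := not_mem_of_not_hasUpperArc hB ht hM h' (i := 0) (k := m + 2) (by omega) (by omega)
    (by omega)
  have f4 := not_mem_of_not_hasUpperArc hB ht hM h' (i := 1) (k := m + 2) (by omega) (by omega)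
    (by omega)
  rw [Nat.cast_zero, add_zero] at f1
  rw [Nat.cast_zero, sub_zero] at f3
  have hz : ((2 * m : ℕ) : ZMod (2 * m)) = 0 := ZMod.natCast_self _
  push_cast at hz
  obtain ⟨i, hi, rfl⟩ := e1 s
  have hi1 : m ≤ i := by
    by_contra! hlt
    exact f1 (hp.half i hlt).1
  obtain ⟨j, rfl⟩ := Nat.exists_eq_add_of_le hi1
  push_cast at f2 f3 f4
  rw [← add_assoc] at f2 f3 f4
  rcases (by omega : j < m - 2 ∨ j = m - 2 ∨ j = m - 1) with hj | rfl | rfl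
  · exact f3 (hp.upper j hj).1
  · apply f4
    have := (hp.upper (m - 3) (by omega)).1
    convert this using 2
    rw [show m - 2 = m - 3 + 1 by omega]
    push_cast; ring
  · apply f2
    have := (hp.half 0 (by omega)).1
    convert this using 2
    rw [Nat.cast_sub (by omega)]
    push_cast
    linear_combination hz

end Perfect

section Numerics

lemma eight_mul_choose_add_lt {m : ℕ} (hm : 9 ≤ m) {j : ℕ} (hj : j + 3 ≤ m) :
    8 * ((2 * m).choose (m + j) : ℝ) < 15 / 16 * chooseGap m * ((m : ℝ) ^ 2 - j ^ 2 - 4 * m) := by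
  have hm' : (9 : ℝ) ≤ m := by exact_mod_cast hm
  have hgap := (chooseGap_facts hm).1
  induction j with
  | zero =>
    have h := (chooseGap_mul m (by omega)).2
    have hc : (0 : ℝ) < (2 * m).choose m := by exact_mod_cast Nat.choose_pos (by omega)
    rw [add_zero]
    have hq : (0 : ℝ) < (m + 1) * (m + 2) := by positivity
    rw [← mul_lt_mul_iff_left₀ hq]
    have h2 : (15 / 16 * chooseGap m * ((m : ℝ) ^ 2 - ((0 : ℕ) : ℝ) ^ 2 - 4 * m)) *
        ((m + 1) * (m + 2)) = (2 * m).choose m * (45 / 16 * m ^ 2 * (m - 4)) := by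
      push_cast
      linear_combination (15 / 16 * ((m : ℝ) ^ 2 - 4 * m)) * h
    rw [h2, mul_comm (8 : ℝ), mul_assoc]
    apply mul_lt_mul_of_pos_left _ hc
    nlinarith
  | succ j ih =>
    have ih := ih (by omega)
    have h := choose_half_succ (m := m) rfl j (by omega)
    have hj' : (j : ℝ) + 4 ≤ m := by exact_mod_cast (by omega : j + 4 ≤ m)
    have hj0 : (0 : ℝ) ≤ j := by positivity
    have hq : (0 : ℝ) < (m : ℝ) + j + 1 := by positivity
    rw [← mul_lt_mul_iff_left₀ hq, mul_assoc, h]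
    have h1 : (8 * ((2 * m).choose (m + j) : ℝ)) * (m - j) <
        15 / 16 * chooseGap m * ((m : ℝ) ^ 2 - j ^ 2 - 4 * m) * (m - j) :=
      mul_lt_mul_of_pos_right ih (by linarith)
    have h2 : ((m : ℝ) ^ 2 - j ^ 2 - 4 * m) * (m - j) ≤
        ((m : ℝ) ^ 2 - (j + 1 : ℕ) ^ 2 - 4 * m) * (m + j + 1) := by
      push_cast
      nlinarith [mul_nonneg hj0 hj0, mul_nonneg (by linarith : (0 : ℝ) ≤ m - j - 4) hj0,
        mul_nonneg (by linarith : (0 : ℝ) ≤ m - j - 4) (by linarith : (0 : ℝ) ≤ m + j),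
        mul_nonneg (by nlinarith : (0 : ℝ) ≤ m ^ 2 - j ^ 2 - 5 * m - j - 1)
          (by linarith : (0 : ℝ) ≤ 2 * j + 1)]
    have h3 := mul_le_mul_of_nonneg_left h2 (by linarith : 0 ≤ 15 / 16 * chooseGap m)
    nlinarith

lemma eight_mul_choose_lt {m : ℕ} (hm : 9 ≤ m) {μ ν : ℕ} (hμ : 3 ≤ μ) (hν : 3 ≤ ν)
    (h : μ + ν = 2 * m) :
    8 * ((2 * m).choose μ : ℝ) < 15 / 16 * chooseGap m * ((μ : ℝ) * ν - 2 * μ - 2 * ν) := by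
  have main : ∀ a b : ℕ, 3 ≤ b → a + b = 2 * m → m ≤ a →
      8 * ((2 * m).choose a : ℝ) < 15 / 16 * chooseGap m * ((a : ℝ) * b - 2 * a - 2 * b) := by
    intro a b hb hab ha
    obtain ⟨j, rfl⟩ := Nat.exists_eq_add_of_le ha
    have hb' : b = m - j := by omega
    convert eight_mul_choose_add_lt hm (j := j) (by omega) using 2
    rw [hb', Nat.cast_sub (by omega)]
    push_cast
    ring
  rcases le_total m μ with hmu | hmu
  · exact main μ ν hν h hmu
  · have h1 := main ν μ hμ (by omega) (by omega)
    rw [Nat.choose_symm_of_eq_add (show 2 * m = μ + ν by omega)]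
    convert h1 using 2
    ring

lemma gap_large {m : ℕ} (hm : 9 ≤ m) : (2 * m * (4 * m + 1) : ℝ) < chooseGap m / 16 := by
  have h := (chooseGap_mul m (by omega)).2
  have hm' : (9 : ℝ) ≤ m := by exact_mod_cast hm
  have key : ∀ k, 9 ≤ k → 32 * (4 * k + 1) * (k + 1) * (k + 2) < 3 * (2 * k).choose k := by
    intro k hk
    induction k, hk using Nat.le_induction with
    | base => decide +kernel
    | succ k hk ih =>
      have h1 := Nat.succ_mul_centralBinom_succ k
      rw [Nat.centralBinom_eq_two_mul_choose, Nat.centralBinom_eq_two_mul_choose] at h1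
      have h2 : 3 * (2 * k).choose k ≤ (2 * (k + 1)).choose (k + 1) := by
        by_contra! hlt
        nlinarith
      nlinarith
  have hk : (32 * (4 * m + 1) * (m + 1) * (m + 2) : ℝ) < 3 * (2 * m).choose m := by
    exact_mod_cast key m hm
  have hq : (0 : ℝ) < (m + 1) * (m + 2) := by positivity
  rw [← mul_lt_mul_iff_left₀ hq, div_mul_eq_mul_div, h]
  have := mul_lt_mul_of_pos_left hk (by linarith : (0 : ℝ) < m)
  nlinarith

lemma succ_mul_add_le_two_mul_choose {a j : ℕ} (ha : 2 ≤ a) (hj : 1 ≤ j) :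
    (j + 1) * (a + j) ≤ 2 * (a + j).choose j := by
  induction a, ha using Nat.le_induction with
  | base =>
    rw [add_comm 2 j, Nat.choose_symm_add, Nat.choose_two_right,
      Nat.mul_div_cancel' (Nat.even_mul_pred_self _).two_dvd,
      show j + 2 - 1 = j + 1 by omega]
    exact (mul_comm _ _).le
  | succ a ha ih =>
    obtain ⟨i, rfl⟩ := Nat.exists_eq_add_of_le' hj
    rw [show a + 1 + (i + 1) = a + (i + 1) + 1 by ring, Nat.choose_succ_succ]
    have h1 : i + 2 ≤ 2 * (a + (i + 1)).choose i := by
      have := Nat.choose_le_choose i (show i + 1 ≤ a + (i + 1) by omega)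
      rw [Nat.choose_succ_self_right] at this
      omega
    nlinarith

lemma mul_factorial_le {a j : ℕ} (ha : 2 ≤ a) (hj : 1 ≤ j) :
    (a + j) * ((j + 1) * (a.factorial * j.factorial)) ≤ 2 * (a + j).factorial := by
  have h := succ_mul_add_le_two_mul_choose ha hj
  have h2 := Nat.add_choose_mul_factorial_mul_factorial a j
  have := Nat.mul_le_mul_right (a.factorial * j.factorial) h
  nlinarith

end Numerics

section ExtremeSets

variable {m : ℕ} [NeZero (2 * m)] {α : Type*} {F G : Finset (Finset α)}

lemma apply_add_mem_arc_add {n : ℕ} [NeZero n] (σ : ZMod n ≃ α) (p : ZMod n) {i j : ℕ} (k : ℕ)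
    (hi : i < n) (hj : j < n) : σ (p + (i : ZMod n)) ∈ arc σ (p + (j : ZMod n)) k ↔
      (j ≤ i ∧ i < j + k) ∨ (i < j ∧ i + n < j + k) := by
  rw [apply_mem_arc]
  rcases le_or_gt j i with h | h
  · obtain ⟨l, rfl⟩ := Nat.exists_eq_add_of_le h
    rw [Nat.cast_add, ← add_assoc, add_mem_cyclicInterval (by omega)]
    omega
  · obtain ⟨l, hl⟩ := Nat.exists_eq_add_of_le (show j ≤ i + n by omega)
    have hl' : (i : ZMod n) = j + l := by
      rw [← Nat.cast_add, ← hl]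
      simp
    rw [hl', ← add_assoc, add_mem_cyclicInterval (by omega)]
    omega

lemma mem_arc_of_forall_ne_mem (hB : ButterflyFree F) {T : Finset α} {y : α} (hT : T ∈ F)
    (hy : ∀ x, x ≠ y → x ∈ T) {n : ℕ} [NeZero n] {σ : ZMod n ≃ α} {s : ZMod n} {k : ℕ}
    (hk : k + 1 < T.card) (hkn : k + 1 < n) (hk0 : 0 < k) (h1 : arc σ s k ∈ F)
    (h2 : arc σ (s + ((1 : ℕ) : ZMod n)) k ∈ F) (h3 : arc σ s (k + 1) ∈ F) : y ∈ arc σ s (k + 1) := by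
  by_contra hy'
  have hsub : arc σ s (k + 1) ⊆ T := fun x hx => hy x fun h => hy' (h ▸ hx)
  have hA := arc_ssubset σ s (i := 0) (k := k) (l := k + 1) (by omega) (by omega) hkn.le
  have hA' := arc_ssubset σ s (i := 1) (k := k) (l := k + 1) (by omega) (by omega) hkn.le
  rw [Nat.cast_zero, add_zero] at hA
  have hD : arc σ s (k + 1) ⊂ T := by
    refine hsub.ssubset_of_ne fun h => ?_
    have := card_arc σ s hkn.le
    rw [h] at this
    omega
  have h := hB.eq_of_ssubset_of_ssubset' h1 h2 h3 hT hA hA' hD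
  have hs : σ s ∈ arc σ s k := by
    rw [apply_mem_arc]
    simpa using (add_mem_cyclicInterval (s := s) (k := k) (i := 0) (by omega)).2 hk0
  rw [h, apply_mem_arc] at hs
  have he : s = s + ((1 : ℕ) : ZMod n) + ((n - 1 : ℕ) : ZMod n) := by
    rw [Nat.cast_sub (by omega)]
    simp
  replace hs : s + ((1 : ℕ) : ZMod n) + ((n - 1 : ℕ) : ZMod n) ∈ cyclicInterval (s + ((1 : ℕ) : ZMod n)) k := by
    rwa [← he]
  rw [add_mem_cyclicInterval (by omega)] at hs
  omega

variable [DecidableEq α]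

lemma not_forall_ne_mem_of_isStandardAt (hB : ButterflyFree F) (hGF : G ⊆ F) (hm : 5 ≤ m)
    {σ : ZMod (2 * m) ≃ α} {p : ZMod (2 * m)} (hp : IsStandardAt m (selectedArcs G σ) p)
    {T : Finset α} (hT : T ∈ F) (hTm : m + 2 < T.card) (y : α) : ¬ ∀ x, x ≠ y → x ∈ T := by
  intro hy
  obtain ⟨i, hi, hyi⟩ := exists_eq_add_natCast p (σ.symm y)
  rw [Equiv.symm_apply_eq] at hyi
  have hhalf : ∀ j < m, arc σ (p + (j : ℕ)) m ∈ F := fun j hj => hGF (hp.half j hj).1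
  have hsucc : ∀ s, arc σ s (m + 1) ∈ F := fun s => hGF (hp.succ s).1
  have hupper : ∀ j < m - 2, arc σ (p + (m + j : ℕ)) (m + 2) ∈ F := by
    intro j hj
    have := hGF (hp.upper j hj).1
    rwa [add_assoc, ← Nat.cast_add] at this
  have h1 : ∀ j, j + 1 < m → y ∈ arc σ (p + (j : ℕ)) (m + 1) := by
    intro j hj
    refine mem_arc_of_forall_ne_mem hB hT hy (by omega) (by omega) (by omega)
      (hhalf j (by omega)) ?_ (hsucc _)
    rw [add_assoc, ← Nat.cast_add]
    exact hhalf _ hj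
  have h2 : ∀ j < m - 2, y ∈ arc σ (p + (m + j : ℕ)) (m + 2) := by
    intro j hj
    exact mem_arc_of_forall_ne_mem hB hT hy (by omega) (by omega) (by omega)
      (hsucc _) (hsucc _) (hupper j hj)
  have a1 := h1 0 (by omega)
  have a2 := h1 (m - 2) (by omega)
  have a3 := h2 0 (by omega)
  have a4 := h2 (m - 3) (by omega)
  rw [hyi, apply_add_mem_arc_add σ p _ hi (by omega)] at a1 a2 a3 a4
  omega

lemma two_le_card_of_isStandardAt (hF : Intersecting F) (hGF : G ⊆ F) (hm : 2 ≤ m)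
    {σ : ZMod (2 * m) ≃ α} {p : ZMod (2 * m)} (hp : IsStandardAt m (selectedArcs G σ) p)
    {T : Finset α} (hT : T ∈ F) : 2 ≤ T.card := by
  by_contra! hlt
  rcases (by omega : T.card = 0 ∨ T.card = 1) with h | h
  · have := hF T hT T hT
    rw [Finset.card_eq_zero] at h
    simp [h] at this
  · obtain ⟨x, rfl⟩ := Finset.card_eq_one.1 h
    have := hF _ hT _ (hGF (hp.succ (σ.symm x + (1 : ℕ))).1)
    rw [Finset.singleton_inter_of_notMem] at this
    · simp at this
    · have hx := apply_add_mem_arc_add σ (σ.symm x) (i := 0) (j := 1) (m + 1) (by omega) (by omega)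
      rw [Nat.cast_zero, add_zero, σ.apply_symm_apply] at hx
      rw [hx]
      omega

end ExtremeSets

section Counting

variable {n : ℕ} [NeZero n] {α : Type*} [Fintype α] [DecidableEq α]

lemma card_arc_eq (hα : Fintype.card α = n) (s : ZMod n) (S : Finset α) :
    (Finset.univ.filter fun σ : ZMod n ≃ α => arc σ s S.card = S).card =
      S.card.factorial * (n - S.card).factorial := by
  have hS : S.card ≤ n := hα ▸ S.card_le_univ
  have hc := card_cyclicInterval s hS
  have h := card_equiv_map_three (β := ZMod n) (α := α) (by rw [ZMod.card, hα])
    (subset_refl (cyclicInterval s S.card)) (subset_refl _) (subset_refl S) (subset_refl S)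
    hc hc hc
  simp only [and_self, Nat.sub_self, Nat.factorial_zero, mul_one, hα] at h
  exact h

lemma card_chain_arcs_eq (hα : Fintype.card α = n) {s : ZMod n} {i l : ℕ} {A M D : Finset α}
    (hAM : A ⊆ M) (hMD : M ⊆ D) (hi : i + A.card ≤ M.card) (hl : l + M.card ≤ D.card) :
    (Finset.univ.filter fun σ : ZMod n ≃ α => arc σ s M.card = M ∧
      arc σ (s + (i : ZMod n)) A.card = A ∧ arc σ (s - (l : ZMod n)) D.card = D).card =
      A.card.factorial * (M.card - A.card).factorial * (D.card - M.card).factorial *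
        (n - D.card).factorial := by
  have hD : D.card ≤ n := hα ▸ D.card_le_univ
  have h2 := cyclicInterval_subset (s - (l : ZMod n)) hl hD
  rw [sub_add_cancel] at h2
  have h := card_equiv_map_three (β := ZMod n) (α := α) (by rw [ZMod.card, hα])
    (cyclicInterval_subset s hi (by omega)) h2 hAM hMD
    (card_cyclicInterval _ (by omega)) (card_cyclicInterval s (by omega))
    (card_cyclicInterval _ hD)
  rw [hα] at h
  rw [← h]
  congr 1
  ext σ
  simp only [Finset.mem_filter, Finset.mem_univ, true_and]
  exact and_left_comm

omit [NeZero n] in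
lemma card_le_of_forall_exists_le {β : Type*} (P : ℕ → β → Prop) (r c : ℕ)
    (h : ∀ i ≤ r, ∀ S : Finset β, (∀ b ∈ S, P i b) → S.card ≤ c) {T : Finset β}
    (hT : ∀ b ∈ T, ∃ i ≤ r, P i b) : T.card ≤ (r + 1) * c := by
  classical
  have hsub : T ⊆ (Finset.range (r + 1)).biUnion fun i => T.filter fun b => P i b := by
    intro b hb
    obtain ⟨i, hi, hP⟩ := hT b hb
    simp only [Finset.mem_biUnion, Finset.mem_range, Finset.mem_filter]
    exact ⟨i, by omega, hb, hP⟩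
  refine (Finset.card_le_card hsub).trans ?_
  refine (Finset.card_biUnion_le_card_mul _ _ c fun i hi => ?_).trans (by simp)
  exact h i (by simpa [Nat.lt_succ_iff] using hi) _ fun b hb => (Finset.mem_filter.1 hb).2

lemma card_le_of_forall_chain_arcs_eq (hα : Fintype.card α = n) {s : ZMod n} {i l : ℕ}
    {A M D : Finset α} (hAM : A ⊆ M) (hMD : M ⊆ D) (hi : i + A.card ≤ M.card)
    (hl : l + M.card ≤ D.card) {S : Finset (ZMod n ≃ α)}
    (hS : ∀ σ ∈ S, arc σ s M.card = M ∧ arc σ (s + (i : ZMod n)) A.card = A ∧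
      arc σ (s - (l : ZMod n)) D.card = D) :
    S.card ≤ A.card.factorial * (M.card - A.card).factorial * (D.card - M.card).factorial *
        (n - D.card).factorial := by
  rw [← card_chain_arcs_eq hα hAM hMD hi hl]
  exact Finset.card_le_card fun σ hσ => Finset.mem_filter.2 ⟨Finset.mem_univ _, hS σ hσ⟩

lemma mul_card_hasLowerArc_le (hα : Fintype.card α = n) (s : ZMod n) {A M D : Finset α}
    (hAM : A ⊂ M) (hA : 2 ≤ A.card) {T : Finset (ZMod n ≃ α)}
    (hT : ∀ σ ∈ T, arc σ s M.card = M ∧ HasLowerArc σ s (A, M, D)) :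
    M.card * T.card ≤ 2 * (M.card.factorial * (n - M.card).factorial) := by
  have hlt := Finset.card_lt_card hAM
  obtain ⟨j, hj⟩ := Nat.exists_eq_add_of_le hlt.le
  have h1 : T.card ≤ (j + 1) * (A.card.factorial * j.factorial * (n - M.card).factorial) := by
    refine card_le_of_forall_exists_le (fun i σ => arc σ s M.card = M ∧
      arc σ (s + (i : ZMod n)) A.card = A) j _ (fun i hi S hS => ?_) ?_
    · have := card_le_of_forall_chain_arcs_eq hα hAM.subset (subset_refl M) (s := s) (i := i)
        (l := 0) (by omega) (by omega) (S := S) fun σ hσ => ⟨(hS σ hσ).1, (hS σ hσ).2, by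
          simpa using (hS σ hσ).1⟩
      rwa [show M.card - A.card = j by omega, Nat.sub_self, Nat.factorial_zero, mul_one] at this
    · intro σ hσ
      obtain ⟨h1, i, h2, h3⟩ := hT σ hσ
      dsimp only at h2 h3
      exact ⟨i, by omega, h1, h3⟩
  have h2 := mul_factorial_le hA (show 1 ≤ j by omega)
  rw [← hj] at h2
  calc _ ≤ M.card * ((j + 1) * (A.card.factorial * j.factorial * (n - M.card).factorial)) :=
        Nat.mul_le_mul_left _ h1
    _ = M.card * ((j + 1) * (A.card.factorial * j.factorial)) * (n - M.card).factorial := by ring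
    _ ≤ 2 * M.card.factorial * (n - M.card).factorial := Nat.mul_le_mul_right _ h2
    _ = _ := mul_assoc _ _ _

lemma mul_card_hasUpperArc_le (hα : Fintype.card α = n) (s : ZMod n) {A M D : Finset α}
    (hMD : M ⊂ D) (hD : D.card + 2 ≤ n) {T : Finset (ZMod n ≃ α)}
    (hT : ∀ σ ∈ T, arc σ s M.card = M ∧ HasUpperArc σ s (A, M, D)) :
    (n - M.card) * T.card ≤ 2 * (M.card.factorial * (n - M.card).factorial) := by
  have hlt := Finset.card_lt_card hMD
  obtain ⟨j, hj⟩ := Nat.exists_eq_add_of_le hlt.le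
  obtain ⟨b, hb⟩ := Nat.exists_eq_add_of_le (show D.card ≤ n by omega)
  have h1 : T.card ≤ (j + 1) * (M.card.factorial * j.factorial * b.factorial) := by
    refine card_le_of_forall_exists_le (fun i σ => arc σ s M.card = M ∧
      arc σ (s - (i : ZMod n)) D.card = D) j _ (fun i hi S hS => ?_) ?_
    · have := card_le_of_forall_chain_arcs_eq hα (subset_refl M) hMD.subset (s := s) (i := 0)
        (l := i) (by omega) (by omega) (S := S) fun σ hσ => ⟨(hS σ hσ).1, by
          simpa using (hS σ hσ).1, (hS σ hσ).2⟩
      rwa [show D.card - M.card = j by omega, show n - D.card = b by omega, Nat.sub_self,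
        Nat.factorial_zero, mul_one] at this
    · intro σ hσ
      obtain ⟨h1, i, h2, h3⟩ := hT σ hσ
      dsimp only at h2 h3
      exact ⟨i, by omega, h1, h3⟩
  have h2 := mul_factorial_le (show 2 ≤ b by omega) (show 1 ≤ j by omega)
  rw [show n - M.card = b + j by omega]
  calc _ ≤ (b + j) * ((j + 1) * (M.card.factorial * j.factorial * b.factorial)) :=
        Nat.mul_le_mul_left _ h1
    _ = (b + j) * ((j + 1) * (b.factorial * j.factorial)) * M.card.factorial := by ring
    _ ≤ 2 * (b + j).factorial * M.card.factorial := Nat.mul_le_mul_right _ h2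
    _ = _ := by ring

lemma mul_card_isArcChain_le (hα : Fintype.card α = n) (s : ZMod n) {A M D : Finset α}
    (hAM : A ⊂ M) (hMD : M ⊂ D) (hA : 2 ≤ A.card) (hD : D.card + 2 ≤ n)
    {T : Finset (ZMod n ≃ α)} (hT : ∀ σ ∈ T, IsArcChain σ s (A, M, D)) :
    M.card * (n - M.card) * T.card ≤ 4 * (M.card.factorial * (n - M.card).factorial) := by
  have hlt := Finset.card_lt_card hMD
  have hlt' := Finset.card_lt_card hAM
  obtain ⟨j, hj⟩ := Nat.exists_eq_add_of_le hlt'.le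
  obtain ⟨e, he⟩ := Nat.exists_eq_add_of_le hlt.le
  obtain ⟨b, hb⟩ := Nat.exists_eq_add_of_le (show D.card ≤ n by omega)
  have h1 : T.card ≤ (j + 1) * ((e + 1) *
      (A.card.factorial * j.factorial * e.factorial * b.factorial)) := by
    refine card_le_of_forall_exists_le (fun i σ => ∃ l ≤ e, arc σ s M.card = M ∧
      arc σ (s + (i : ZMod n)) A.card = A ∧ arc σ (s - (l : ZMod n)) D.card = D) j _
      (fun i hi S hS => card_le_of_forall_exists_le _ _ _ (fun l hl S' hS' => ?_) hS) ?_
    · have := card_le_of_forall_chain_arcs_eq hα hAM.subset hMD.subset (s := s) (i := i)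
        (l := l) (by omega) (by omega) hS'
      rwa [show D.card - M.card = e by omega, show n - D.card = b by omega,
        show M.card - A.card = j by omega] at this
    · intro σ hσ
      obtain ⟨h1, ⟨i, h2, h3⟩, ⟨l, h4, h5⟩⟩ := hT σ hσ
      dsimp only at h1 h2 h3 h4 h5
      exact ⟨i, by omega, l, by omega, h1, h3, h5⟩
  have h2 := mul_factorial_le (show 2 ≤ b by omega) (show 1 ≤ e by omega)
  have h3 := mul_factorial_le hA (show 1 ≤ j by omega)
  rw [← hj] at h3
  rw [show n - M.card = b + e by omega]
  calc _ ≤ M.card * (b + e) * ((j + 1) * ((e + 1) *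
        (A.card.factorial * j.factorial * e.factorial * b.factorial))) := Nat.mul_le_mul_left _ h1
    _ = (M.card * ((j + 1) * (A.card.factorial * j.factorial))) *
        ((b + e) * ((e + 1) * (b.factorial * e.factorial))) := by ring
    _ ≤ (2 * M.card.factorial) * (2 * (b + e).factorial) := Nat.mul_le_mul h3 h2
    _ = _ := by ring

end Counting

section Averaging

variable {n : ℕ} [NeZero n] {α : Type*} [DecidableEq α] {F : Finset (Finset α)}

open scoped Classical in
lemma sum_choose_le_sum_startLengths_add (hF : Intersecting F)
    (hpos : ∀ S ∈ F, 0 < S.card) (hlt : ∀ S ∈ F, S.card < n) (σ : ZMod n ≃ α) (s : ZMod n) :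
    ∑ S ∈ F, (if arc σ s S.card = S then (n.choose S.card : ℝ) else 0) ≤
      ∑ k ∈ startLengths (selectedArcs F σ) s, (n.choose k : ℝ) +
        ∑ t ∈ chainTriples F, if IsArcChain σ s t then (n.choose t.2.1.card : ℝ) else 0 := by
  rw [← Finset.sum_filter, ← Finset.sum_filter]
  rw [← Finset.sum_filter_add_sum_filter_not _
    (fun S : Finset α => S.card ∈ startLengths (selectedArcs F σ) s)]
  refine add_le_add ?_ ?_
  · rw [← Finset.sum_image (f := fun k => (n.choose k : ℝ)) (g := Finset.card)]
    · refine Finset.sum_le_sum_of_subset_of_nonneg ?_ fun _ _ _ => by positivity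
      intro k hk
      obtain ⟨S, hS, rfl⟩ := Finset.mem_image.1 hk
      exact (Finset.mem_filter.1 hS).2
    · intro S hS T hT h
      simp only [Finset.coe_filter, Finset.mem_filter, Set.mem_ofPred_eq] at hS hT
      rw [← hS.1.2, ← hT.1.2, h]
  · have hsub : (F.filter fun S => arc σ s S.card = S).filter
        (fun S => S.card ∉ startLengths (selectedArcs F σ) s) ⊆
        ((chainTriples F).filter fun t => IsArcChain σ s t).image fun t => t.2.1 := by
      intro S hS
      simp only [Finset.mem_filter] at hS
      obtain ⟨⟨hSF, hS⟩, hSl⟩ := hS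
      rw [(isArcFamily_selectedArcs hF σ).mem_startLengths, selectedArcs] at hSl
      simp only [hS, hSF, hpos S hSF, hlt S hSF, true_and, not_forall, not_not] at hSl
      obtain ⟨t, ht, htS, hc⟩ := hSl
      exact Finset.mem_image.2 ⟨t, Finset.mem_filter.2 ⟨ht, hc⟩, htS⟩
    refine (Finset.sum_le_sum_of_subset_of_nonneg hsub fun _ _ _ => by positivity).trans ?_
    exact Finset.sum_image_le_of_nonneg (f := fun S : Finset α => (n.choose S.card : ℝ))
      (g := fun t : Finset α × Finset α × Finset α => t.2.1) fun _ _ => by positivity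

lemma sum_ite_arc_eq [Fintype α] (hα : Fintype.card α = n) (s : ZMod n) :
    ∑ σ : ZMod n ≃ α, ∑ S ∈ F, (if arc σ s S.card = S then (n.choose S.card : ℝ) else 0) =
      n.factorial * F.card := by
  rw [Finset.sum_comm, mul_comm, ← nsmul_eq_mul]
  refine Finset.sum_eq_card_nsmul fun S _ => ?_
  have hS : S.card ≤ n := hα ▸ S.card_le_univ
  rw [← Finset.sum_filter, Finset.sum_const, nsmul_eq_mul, card_arc_eq hα]
  rw [← Nat.choose_mul_factorial_mul_factorial hS]
  push_cast
  ring

open scoped Classical in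
/-- The contribution of the chain `t` and the point `s` to the averaging argument. -/
noncomputable def chainExcess (m : ℕ) [NeZero (2 * m)] (σ : ZMod (2 * m) ≃ α)
    (s : ZMod (2 * m)) (t : Finset α × Finset α × Finset α) : ℝ :=
  15 / 16 * chooseGap m * ((if arc σ s t.2.1.card = t.2.1 then 1 else 0) -
    (if arc σ s t.2.1.card = t.2.1 ∧ HasLowerArc σ s t then 1 else 0) -
    (if arc σ s t.2.1.card = t.2.1 ∧ HasUpperArc σ s t then 1 else 0)) -
    2 * if IsArcChain σ s t then ((2 * m).choose t.2.1.card : ℝ) else 0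

variable {m : ℕ} [NeZero (2 * m)]

lemma sum_chainExcess_pos [Fintype α] (hα : Fintype.card α = 2 * m) (hm : 9 ≤ m)
    (s : ZMod (2 * m)) {A M D : Finset α} (hAM : A ⊂ M) (hMD : M ⊂ D) (hA : 2 ≤ A.card)
    (hD : D.card + 2 ≤ 2 * m) : 0 < ∑ σ : ZMod (2 * m) ≃ α, chainExcess m σ s (A, M, D) := by
  classical
  have h1 := Finset.card_lt_card hAM
  have h2 := Finset.card_lt_card hMD
  obtain ⟨ν, hν⟩ := Nat.exists_eq_add_of_le (show M.card ≤ 2 * m by omega)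
  have hX := card_arc_eq hα s M
  have hY := mul_card_hasLowerArc_le hα s (D := D) hAM hA
    (T := Finset.univ.filter fun σ => arc σ s M.card = M ∧ HasLowerArc σ s (A, M, D)) (by simp)
  have hZ := mul_card_hasUpperArc_le hα s (A := A) hMD hD
    (T := Finset.univ.filter fun σ => arc σ s M.card = M ∧ HasUpperArc σ s (A, M, D)) (by simp)
  have hW := mul_card_isArcChain_le hα s hAM hMD hA hD
    (T := Finset.univ.filter fun σ => IsArcChain σ s (A, M, D)) (by simp)
  have hgap := (chooseGap_facts hm).1
  have key := eight_mul_choose_lt hm (μ := M.card) (ν := ν) (by omega) (by omega) hν.symm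
  rw [show 2 * m - M.card = ν by omega] at hX hY hZ hW
  have hP : 0 < M.card.factorial * ν.factorial := by positivity
  simp only [chainExcess, Finset.sum_sub_distrib, ← Finset.mul_sum, Finset.sum_ite,
    Finset.sum_const_zero, Finset.sum_const, add_zero, nsmul_eq_mul, mul_one]
  rw [hX]
  generalize M.card.factorial * ν.factorial = P at *
  generalize (Finset.univ.filter fun σ : ZMod (2 * m) ≃ α =>
    arc σ s M.card = M ∧ HasLowerArc σ s (A, M, D)).card = Y at *
  generalize (Finset.univ.filter fun σ : ZMod (2 * m) ≃ α =>
    arc σ s M.card = M ∧ HasUpperArc σ s (A, M, D)).card = Z at *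
  generalize (Finset.univ.filter fun σ : ZMod (2 * m) ≃ α =>
    IsArcChain σ s (A, M, D)).card = W at *
  have hμ : (0 : ℝ) < M.card := by exact_mod_cast (by omega : 0 < M.card)
  have hν0 : (0 : ℝ) < ν := by exact_mod_cast (by omega : 0 < ν)
  generalize M.card = μ at *
  have hY' : (μ * Y : ℝ) ≤ 2 * P := by exact_mod_cast hY
  have hZ' : (ν * Z : ℝ) ≤ 2 * P := by exact_mod_cast hZ
  have hW' : (μ * ν * W : ℝ) ≤ 4 * P := by exact_mod_cast hW
  have hP' : (0 : ℝ) < P := by exact_mod_cast hP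
  have hC : (0 : ℝ) ≤ (2 * m).choose μ := by positivity
  generalize ((2 * m).choose μ : ℝ) = C at *
  rw [← mul_pos_iff_of_pos_left (mul_pos hμ hν0)]
  have e1 := mul_le_mul_of_nonneg_left hW' hC
  have e2 := mul_le_mul_of_nonneg_left hY' (mul_pos hgap hν0).le
  have e3 := mul_le_mul_of_nonneg_left hZ' (mul_pos hgap hμ).le
  have e4 := mul_lt_mul_of_pos_right key hP'
  nlinarith

lemma arcDeficit_bounds (hF : Intersecting F) (hB : ButterflyFree F) (hm : 9 ≤ m)
    (hsize : ∀ S ∈ F, S.card ≤ 2 * m) (σ : ZMod (2 * m) ≃ α) :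
    15 / 16 * chooseGap m * (isolatedPoints F σ).card ≤ arcDeficit m (selectedArcs F σ) ∧
      (¬ IsPerfect m (selectedArcs F σ) →
        15 / 16 * chooseGap m * (isolatedPoints F σ).card + chooseGap m / 8 ≤
          arcDeficit m (selectedArcs F σ)) := by
  have hg := isArcFamily_selectedArcs hF σ
  have hgap := (chooseGap_facts hm).1
  by_cases hp : IsPerfect m (selectedArcs F σ)
  · obtain ⟨p, hp'⟩ := hg.exists_isStandardAt (by omega) hp
    rw [isolatedPoints_eq_empty hB (by omega) hsize hp']
    have := hg.arcDeficit_nonneg_of_isPerfect hm hp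
    exact ⟨by simpa using this, fun h => absurd hp h⟩
  · have h1 := hg.gap_le_arcDeficit hm hp
    have h2 := hg.gap_mul_card_le_arcDeficit hm hp (isolatedPoints F σ)
      fun s hs => card_startLengths_of_mem_isolatedPoints hF hB hsize hs
    constructor <;> intros <;> linarith

lemma sum_chainExcess_le (hF : Intersecting F) (hB : ButterflyFree F) (hm : 9 ≤ m)
    (hsize : ∀ S ∈ F, 0 < S.card ∧ S.card < 2 * m) (σ : ZMod (2 * m) ≃ α) :
    ∑ s : ZMod (2 * m), ∑ t ∈ chainTriples F, chainExcess m σ s t ≤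
      15 / 16 * chooseGap m * (isolatedPoints F σ).card + 2 * arcWeight (selectedArcs F σ) -
      2 * ∑ s : ZMod (2 * m), ∑ S ∈ F,
        if arc σ s S.card = S then ((2 * m).choose S.card : ℝ) else 0 := by
  classical
  have hgap := (chooseGap_facts hm).1
  have h1 : ∀ s : ZMod (2 * m), ∑ t ∈ chainTriples F, chainExcess m σ s t ≤
      15 / 16 * chooseGap m * ((chainTriples F).filter fun t : Finset α × Finset α × Finset α =>
      arc σ s t.2.1.card = t.2.1 ∧ ¬ HasLowerArc σ s t ∧ ¬ HasUpperArc σ s t).card -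
      2 * ∑ t ∈ chainTriples F,
        if IsArcChain σ s t then ((2 * m).choose t.2.1.card : ℝ) else 0 := by
    intro s
    rw [Finset.card_filter, Nat.cast_sum, Finset.mul_sum, Finset.mul_sum,
      ← Finset.sum_sub_distrib]
    refine Finset.sum_le_sum fun t _ => ?_
    rw [chainExcess]
    refine sub_le_sub_right (mul_le_mul_of_nonneg_left ?_ (by positivity)) _
    by_cases a : arc σ s t.2.1.card = t.2.1 <;> by_cases b : HasLowerArc σ s t <;>
      by_cases c : HasUpperArc σ s t <;> simp [a, b, c]
  have h2 : ∀ s : ZMod (2 * m), _ := sum_choose_le_sum_startLengths_add hF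
    (fun S hS => (hsize S hS).1) (fun S hS => (hsize S hS).2) σ
  have h3 : ((∑ s : ZMod (2 * m), ((chainTriples F).filter
      fun t : Finset α × Finset α × Finset α => arc σ s t.2.1.card = t.2.1 ∧
      ¬ HasLowerArc σ s t ∧ ¬ HasUpperArc σ s t).card : ℕ) : ℝ) ≤ (isolatedPoints F σ).card := by
    exact_mod_cast sum_isolated_le_card hB (fun S hS => (hsize S hS).2.le) σ
  have h1' := Finset.sum_le_sum fun s (_ : s ∈ Finset.univ) => h1 s
  have h2' := Finset.sum_le_sum fun s (_ : s ∈ Finset.univ) => h2 s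
  rw [Finset.sum_sub_distrib, ← Finset.mul_sum, ← Finset.mul_sum, ← Nat.cast_sum] at h1'
  rw [Finset.sum_add_distrib] at h2'
  have h4 := mul_le_mul_of_nonneg_left h3 (by positivity : 0 ≤ 15 / 16 * chooseGap m)
  rw [arcWeight]
  linarith

lemma sum_arcDeficit_le [Fintype α] (hα : Fintype.card α = 2 * m) (hF : Intersecting F)
    (hB : ButterflyFree F) (hm : 9 ≤ m) (hsize : ∀ S ∈ F, 0 < S.card ∧ S.card < 2 * m) :
    ∑ σ : ZMod (2 * m) ≃ α, (arcDeficit m (selectedArcs F σ) -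
        15 / 16 * chooseGap m * (isolatedPoints F σ).card) +
      ∑ s : ZMod (2 * m), ∑ t ∈ chainTriples F, ∑ σ : ZMod (2 * m) ≃ α, chainExcess m σ s t ≤
    (2 * m).factorial * (2 * (m * ((2 * m).choose m : ℝ) + 2 * m * (2 * m).choose (m + 1) +
    (m - 2) * (2 * m).choose (m + 2)) - 4 * m * F.card) := by
  have h1 := Finset.sum_le_sum fun σ (_ : σ ∈ Finset.univ) => sum_chainExcess_le hF hB hm hsize σ
  have hcard : (Finset.univ : Finset (ZMod (2 * m) ≃ α)).card = (2 * m).factorial := by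
    rw [Finset.card_univ, Fintype.card_equiv (Fintype.equivOfCardEq (by rw [ZMod.card, hα])),
      ZMod.card]
  have h2 : ∑ σ : ZMod (2 * m) ≃ α, ∑ s : ZMod (2 * m), ∑ S ∈ F,
      (if arc σ s S.card = S then ((2 * m).choose S.card : ℝ) else 0) =
      (2 * m : ℕ) * ((2 * m).factorial * F.card) := by
    rw [Finset.sum_comm]
    simp only [sum_ite_arc_eq hα, Finset.sum_const, Finset.card_univ, ZMod.card, nsmul_eq_mul]
  have h3 : ∑ s : ZMod (2 * m), ∑ t ∈ chainTriples F, ∑ σ : ZMod (2 * m) ≃ α,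
      chainExcess m σ s t = ∑ σ : ZMod (2 * m) ≃ α, ∑ s : ZMod (2 * m), ∑ t ∈ chainTriples F,
      chainExcess m σ s t := by
    rw [Finset.sum_comm (s := Finset.univ (α := ZMod (2 * m) ≃ α))]
    exact Finset.sum_congr rfl fun s _ => Finset.sum_comm
  simp only [arcDeficit, Finset.sum_sub_distrib, Finset.sum_add_distrib, Finset.sum_const,
    hcard, ← Finset.mul_sum, nsmul_eq_mul] at h1 ⊢
  rw [h2] at h1
  rw [h3]
  push_cast at h1
  linarith

end Averaging

section Extremal

variable {m : ℕ} {α : Type*} [DecidableEq α] {F : Finset (Finset α)}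

lemma two_mul_mul_sigmaI (hm : 3 ≤ m) : 2 * m * (SigmaI (2 * m) 2 : ℝ) =
    m * ((2 * m).choose m : ℝ) + 2 * m * (2 * m).choose (m + 1) +
      (m - 2) * (2 * m).choose (m + 2) := by
  have h : SigmaI (2 * m) 2 =
      (2 * m - 1).choose (m - 1) + (2 * m).choose (m + 1) + (2 * m - 1).choose (m + 2) := by
    rw [SigmaI, if_neg (by omega), Nat.mul_div_cancel_left _ (by norm_num),
      show m + 2 - 1 = m + 1 by omega]
    simp
  obtain ⟨k, rfl⟩ := Nat.exists_eq_add_of_le' (show 1 ≤ m by omega)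
  have h1 := Nat.add_one_mul_choose_eq (2 * (k + 1) - 1) k
  have h2 := Nat.choose_mul_succ_eq (2 * (k + 1) - 1) (k + 1 + 2)
  rw [show 2 * (k + 1) - 1 + 1 = 2 * (k + 1) by omega] at h1
  rw [show 2 * (k + 1) - 1 + 1 = 2 * (k + 1) by omega,
    show 2 * (k + 1) - (k + 1 + 2) = k - 1 by omega] at h2
  rw [h, Nat.add_sub_cancel]
  have h1' : (2 * (k + 1) : ℝ) * (2 * (k + 1) - 1).choose k =
    (2 * (k + 1)).choose (k + 1) * (k + 1) := by exact_mod_cast h1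
  have h2' : ((2 * (k + 1) - 1).choose (k + 1 + 2) : ℝ) * (2 * (k + 1)) =
    (2 * (k + 1)).choose (k + 1 + 2) * (k - 1 : ℕ) := by exact_mod_cast h2
  rw [Nat.cast_sub (by omega)] at h2'
  push_cast at h1' h2' ⊢
  linear_combination h1' + h2'

lemma card_filter_extreme_le [Fintype α] (hα : Fintype.card α = 2 * m) (hm : 1 ≤ m)
    (hF : ∀ S ∈ F, S.card ≤ 2 * m) (h0 : ∅ ∉ F) :
    (F.filter fun S => ¬ (2 ≤ S.card ∧ S.card + 2 ≤ 2 * m)).card ≤ 4 * m + 1 := by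
  have hsub : (F.filter fun S => ¬ (2 ≤ S.card ∧ S.card + 2 ≤ 2 * m)) ⊆
      (Finset.univ.powersetCard 1 ∪ Finset.univ.powersetCard (2 * m - 1)) ∪
        Finset.univ.powersetCard (2 * m) := by
    intro S hS
    rw [Finset.mem_filter] at hS
    have h1 : S.card ≠ 0 := fun h => h0 (Finset.card_eq_zero.1 h ▸ hS.1)
    have h2 := hF S hS.1
    simp only [Finset.mem_union, Finset.mem_powersetCard, Finset.subset_univ, true_and]
    omega
  refine (Finset.card_le_card hsub).trans ((Finset.card_union_le _ _).trans ?_)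
  have := Finset.card_union_le ((Finset.univ : Finset α).powersetCard 1)
    (Finset.univ.powersetCard (2 * m - 1))
  simp only [Finset.card_powersetCard, Finset.card_univ, hα, Nat.choose_one_right,
    Nat.choose_self, Nat.choose_symm (show 1 ≤ 2 * m by omega)] at this ⊢
  omega

variable [Fintype α] [NeZero (2 * m)]

lemma not_isPerfect_of_extreme (hα : Fintype.card α = 2 * m) (hF : Intersecting F)
    (hB : ButterflyFree F) (hm : 9 ≤ m) {G : Finset (Finset α)} (hGF : G ⊆ F) {T : Finset α}
    (hT : T ∈ F) (hT2 : ¬ (2 ≤ T.card ∧ T.card + 2 ≤ 2 * m)) (σ : ZMod (2 * m) ≃ α) :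
    ¬ IsPerfect m (selectedArcs G σ) := by
  intro hp
  have hG : Intersecting G := fun A hA B hB => hF A (hGF hA) B (hGF hB)
  obtain ⟨p, hp⟩ := (isArcFamily_selectedArcs hG σ).exists_isStandardAt (by omega) hp
  have h2 := two_le_card_of_isStandardAt hF hGF (by omega) hp hT
  have hc : Tᶜ.card ≤ 1 := by
    rw [Finset.card_compl, hα]
    omega
  have : Nonempty α := ⟨σ 0⟩
  obtain ⟨y, hy⟩ := Finset.card_le_one_iff_subset_singleton.1 hc
  refine not_forall_ne_mem_of_isStandardAt hB hGF (by omega) hp hT (by omega) y fun x hx => ?_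
  by_contra hxT
  exact hx (Finset.mem_singleton.1 (hy (Finset.mem_compl.2 hxT)))

/-- In a family of extremal size there are no chains of three sets, and every cyclic ordering is
perfect. -/
lemma chainTriples_eq_empty_and_isPerfect (hα : Fintype.card α = 2 * m) (hF : Intersecting F)
    (hB : ButterflyFree F) (hm : 9 ≤ m) (hcard : F.card = SigmaI (2 * m) 2) :
    chainTriples F = ∅ ∧ ∀ σ : ZMod (2 * m) ≃ α, IsPerfect m (selectedArcs F σ) := by
  have hsize : ∀ S ∈ F, S.card ≤ 2 * m := fun S _ => hα ▸ S.card_le_univ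
  have hgap := (chooseGap_facts hm).1
  have hfac : (0 : ℝ) < (2 * m).factorial := by exact_mod_cast Nat.factorial_pos _
  have hequiv : (Finset.univ : Finset (ZMod (2 * m) ≃ α)).card = (2 * m).factorial := by
    rw [Finset.card_univ, Fintype.card_equiv (Fintype.equivOfCardEq (by rw [ZMod.card, hα])),
      ZMod.card]
  set G := F.filter fun S => 2 ≤ S.card ∧ S.card + 2 ≤ 2 * m with hGdef
  have hGF : G ⊆ F := Finset.filter_subset _ _
  have hG : Intersecting G := fun A hA B hB => hF A (hGF hA) B (hGF hB)
  have hBG : ButterflyFree G := by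
    rintro ⟨A, B, C, D, hA, hB', hC, hD, h⟩
    exact hB ⟨A, B, C, D, hGF hA, hGF hB', hGF hC, hGF hD, h⟩
  have hGsize : ∀ S ∈ G, 2 ≤ S.card ∧ S.card + 2 ≤ 2 * m := fun S hS => (Finset.mem_filter.1 hS).2
  have hbound := fun σ => arcDeficit_bounds hG hBG hm (fun S hS => hsize S (hGF hS)) σ
  have hsum := sum_arcDeficit_le hα hG hBG hm fun S hS => by have := hGsize S hS; omega
  rw [← two_mul_mul_sigmaI (by omega), ← hcard] at hsum
  have hpos : ∀ s : ZMod (2 * m), ∀ t ∈ chainTriples G,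
      0 < ∑ σ : ZMod (2 * m) ≃ α, chainExcess m σ s t := by
    rintro s ⟨A, M, D⟩ ht
    rw [mem_chainTriples] at ht
    exact sum_chainExcess_pos hα hm s ht.2.2.2.1 ht.2.2.2.2 (hGsize A ht.1).1
      (hGsize D ht.2.2.1).2
  have hnonneg : 0 ≤ ∑ s : ZMod (2 * m), ∑ t ∈ chainTriples G,
      ∑ σ : ZMod (2 * m) ≃ α, chainExcess m σ s t :=
    Finset.sum_nonneg fun s _ => Finset.sum_nonneg fun t ht => (hpos s t ht).le
  have hc := Finset.card_filter_add_card_filter_not (s := F)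
    (fun S => 2 ≤ S.card ∧ S.card + 2 ≤ 2 * m)
  have hall : ∀ S ∈ F, 2 ≤ S.card ∧ S.card + 2 ≤ 2 * m := by
    by_contra! hex
    obtain ⟨T, hT, hT2⟩ := hex
    have hT2' : ¬ (2 ≤ T.card ∧ T.card + 2 ≤ 2 * m) := fun h => by
      have := hT2 h.1
      omega
    have hnp := not_isPerfect_of_extreme hα hF hB hm hGF hT hT2'
    have h1 : ((2 * m).factorial : ℝ) * (chooseGap m / 8) ≤
        ∑ σ : ZMod (2 * m) ≃ α, (arcDeficit m (selectedArcs G σ) -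
        15 / 16 * chooseGap m * (isolatedPoints G σ).card) := by
      rw [← hequiv, ← nsmul_eq_mul]
      refine Finset.card_nsmul_le_sum _ _ _ fun σ _ => ?_
      have := (hbound σ).2 (hnp σ)
      linarith
    have h2 := card_filter_extreme_le hα (by omega) hsize fun h0 => by
      have := hF ∅ h0 ∅ h0
      simp at this
    have h3 : (F.card : ℝ) ≤ G.card + (4 * m + 1) := by
      rw [← hc]
      exact_mod_cast Nat.add_le_add_left h2 _
    have h4 := gap_large hm
    have h5 : ((2 * m).factorial : ℝ) * (chooseGap m / 8) ≤
        (2 * m).factorial * (2 * (2 * m * F.card) - 4 * m * G.card) := by linarith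
    have h6 := le_of_mul_le_mul_left h5 hfac
    have hm0 : (0 : ℝ) ≤ m := by positivity
    nlinarith
  have hGeq : G = F := Finset.filter_eq_self.2 hall
  rw [hGeq] at hsum hbound hpos hnonneg
  have hzero : ((2 * m).factorial : ℝ) * (2 * (2 * m * F.card) - 4 * m * F.card) = 0 := by ring
  rw [hzero] at hsum
  have hnonneg' : ∀ σ ∈ Finset.univ, 0 ≤ arcDeficit m (selectedArcs F σ) -
      15 / 16 * chooseGap m * (isolatedPoints F σ).card := fun σ _ => by
    have := (hbound σ).1
    linarith
  have hnn := Finset.sum_nonneg hnonneg'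
  constructor
  · by_contra hne
    have : 0 < ∑ s : ZMod (2 * m), ∑ t ∈ chainTriples F,
        ∑ σ : ZMod (2 * m) ≃ α, chainExcess m σ s t :=
      Finset.sum_pos (fun s _ => Finset.sum_pos (hpos s) (Finset.nonempty_iff_ne_empty.2 hne))
        Finset.univ_nonempty
    linarith
  · intro σ
    by_contra hnp
    have h1 := (Finset.sum_eq_zero_iff_of_nonneg hnonneg').1 (by linarith) σ (Finset.mem_univ _)
    have h2 := (hbound σ).2 hnp
    linarith

end Extremal

section Uniqueness

open scoped Classical in
lemma exists_equiv_lt_iff {n : ℕ} [NeZero n] {α : Type*} [Fintype α] (hα : Fintype.card α = n)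
    (h : α → ℕ) : ∃ σ : ZMod n ≃ α, ∀ i c, h (σ i) < c ↔
      i.val < (Finset.univ.filter fun a => h a < c).card := by
  obtain ⟨k, rfl⟩ : ∃ k, n = k + 1 := Nat.exists_eq_succ_of_ne_zero (NeZero.ne n)
  let e : Fin (k + 1) ≃ α := Fintype.equivOfCardEq (by simp [hα])
  let σ : Fin (k + 1) ≃ α := (Tuple.sort (h ∘ e)).trans e
  have hmono : Monotone (h ∘ σ) := Tuple.monotone_sort (h ∘ e)
  refine ⟨σ, fun (i : Fin (k + 1)) c => ?_⟩
  change h (σ i) < c ↔ i.val < _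
  have hcard : (Finset.univ.filter fun a => h a < c).card =
      (Finset.univ.filter fun i => h (σ i) < c).card := by
    rw [Finset.card_filter, Finset.card_filter, ← Equiv.sum_comp σ]
  rw [hcard]
  constructor
  · intro hi
    have hsub : Finset.Iic i ⊆ Finset.univ.filter fun i => h (σ i) < c := fun j hj =>
      Finset.mem_filter.2 ⟨Finset.mem_univ _, (hmono (Finset.mem_Iic.1 hj)).trans_lt hi⟩
    have := Finset.card_le_card hsub
    rw [Fin.card_Iic] at this
    omega
  · intro hi
    by_contra! hc
    have hsub : (Finset.univ.filter fun i => h (σ i) < c) ⊆ Finset.Iio i := fun j hj => by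
      rw [Finset.mem_Iio]
      by_contra! hij
      have := hmono hij
      have := (Finset.mem_filter.1 hj).2
      simp only [Function.comp_apply] at *
      omega
    have := Finset.card_le_card hsub
    rw [Fin.card_Iio] at this
    omega

lemma exists_arc_zero_eq {n : ℕ} [NeZero n] {α : Type*} [Fintype α] (hα : Fintype.card α = n)
    (S : Finset α) : ∃ σ : ZMod n ≃ α, arc σ 0 S.card = S := by
  classical
  obtain ⟨σ, hσ⟩ := exists_equiv_lt_iff hα fun a => if a ∈ S then 0 else 1
  refine ⟨σ, Finset.ext fun a => ?_⟩
  obtain ⟨i, rfl⟩ := σ.surjective a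
  have := hσ i 1
  have h : ∀ a, (if a ∈ S then 0 else 1) < 1 ↔ a ∈ S := fun a => by split_ifs <;> simp [*]
  simp only [h, Finset.filter_univ_mem] at this
  rw [apply_mem_arc, mem_cyclicInterval, sub_zero, this]

variable {m : ℕ} [NeZero (2 * m)] {α : Type*} [DecidableEq α] {F : Finset (Finset α)}

/-- The arcs of `σ` in `F` are those of the extremal family with centre `x`. -/
structure IsCentre (m : ℕ) [NeZero (2 * m)] (F : Finset (Finset α)) (σ : ZMod (2 * m) ≃ α)
    (x : α) : Prop where
  half : ∀ s, arc σ s m ∈ F ↔ x ∈ arc σ s m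
  succ : ∀ s, arc σ s (m + 1) ∈ F
  upper : ∀ s, arc σ s (m + 2) ∈ F ↔ x ∉ arc σ s (m + 2)
  length : ∀ s k, 0 < k → k < 2 * m → arc σ s k ∈ F → k = m ∨ k = m + 1 ∨ k = m + 2

lemma IsStandardAt.isCentre (hm : 3 ≤ m) (hC : chainTriples F = ∅) {σ : ZMod (2 * m) ≃ α}
    {p : ZMod (2 * m)} (hp : IsStandardAt m (selectedArcs F σ) p) :
    IsCentre m F σ (σ (p + ((m - 1 : ℕ) : ZMod (2 * m)))) := by
  have hsel : ∀ s k, 0 < k → k < 2 * m → (selectedArcs F σ s k ↔ arc σ s k ∈ F) := by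
    intro s k h1 h2
    simp [selectedArcs, h1, h2, hC]
  refine ⟨fun s => ?_, fun s => (hsel s _ (by omega) (by omega)).1 (hp.succ s), fun s => ?_,
    fun s k h1 h2 h => hp.length s k ((hsel s k h1 h2).2 h)⟩
  · rw [← hsel s m (by omega) (by omega)]
    obtain ⟨i, hi, rfl⟩ := exists_eq_add_natCast p s
    rw [apply_add_mem_arc_add σ p m (by omega) hi]
    rcases lt_or_ge i m with h | h
    · have := hp.half i h
      simp only [this, true_iff]
      omega
    · obtain ⟨j, rfl⟩ := Nat.exists_eq_add_of_le h
      have := hp.not_half j (by omega)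
      rw [add_assoc, ← Nat.cast_add] at this
      simp only [this, false_iff]
      omega
  · rw [← hsel s _ (by omega) (by omega)]
    obtain ⟨i, hi, rfl⟩ := exists_eq_add_natCast p s
    rw [apply_add_mem_arc_add σ p _ (by omega) hi]
    constructor
    · intro h
      obtain ⟨j, hj, hij⟩ := hp.of_upper _ h
      rw [add_assoc, ← Nat.cast_add, add_left_cancel_iff, ZMod.natCast_eq_natCast_iff',
        Nat.mod_eq_of_lt hi, Nat.mod_eq_of_lt (by omega)] at hij
      omega
    · intro h
      obtain ⟨j, rfl⟩ := Nat.exists_eq_add_of_le (show m ≤ i by omega)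
      have := hp.upper j (by omega)
      rwa [add_assoc, ← Nat.cast_add] at this

lemma exists_swap_labelling [Fintype α] {A S : Finset α} {x y : α} (hx : x ∈ A) (hy : y ∉ A)
    (hxS : x ∈ S) (hyS : y ∉ S) : ∃ h : α → ℕ, (∀ a, h a < 1 ↔ a ∈ ({x} : Finset α)) ∧
      (∀ a, h a < 2 ↔ a ∈ A ∩ S) ∧ (∀ a, h a < 3 ↔ a ∈ A) ∧ (∀ a, h a < 4 ↔ a ∈ insert y A) ∧
      ∀ a, h a < 5 ↔ a ∈ (S \ A)ᶜ := by
  refine ⟨fun a => if a = x then 0 else if a = y then 3 else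
    if a ∈ A then (if a ∈ S then 1 else 2) else (if a ∈ S then 5 else 4), ?_⟩
  simp only [← forall_and, Finset.mem_singleton, Finset.mem_inter, Finset.mem_insert,
    Finset.mem_compl, Finset.mem_sdiff]
  intro a
  grind

variable [Fintype α]

lemma compl_arc (hα : Fintype.card α = 2 * m) (σ : ZMod (2 * m) ≃ α) :
    (arc σ 0 m)ᶜ = arc σ ((m : ℕ) : ZMod (2 * m)) m := by
  have hm : m ≤ 2 * m := by omega
  symm
  have h := arc_disjoint σ 0 (i := m) (k := m) (l := m) le_rfl (by omega)
  rw [zero_add] at h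
  apply Finset.eq_of_subset_of_card_le
  · exact Finset.subset_compl_iff_disjoint_left.2 h
  · rw [Finset.card_compl, card_arc σ _ hm, card_arc σ _ hm, hα]
    omega

/-- If swapping `x` for `y` takes `A` out of the family, then all half-sized sets that contain `x`
but not `y` belong to it. -/
lemma mem_of_swap_not_mem (hα : Fintype.card α = 2 * m)
    (hF : ∀ σ : ZMod (2 * m) ≃ α, ∃ x, IsCentre m F σ x) {A S : Finset α} {x y : α}
    (hA : A ∈ F) (hAm : A.card = m) (hx : x ∈ A) (hy : y ∉ A) (hxy : insert y (A.erase x) ∉ F)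
    (hSm : S.card = m) (hxS : x ∈ S) (hyS : y ∉ S) : S ∈ F := by
  classical
  have hxy' : x ≠ y := fun h => hy (h ▸ hx)
  have hm : 0 < m := hAm ▸ Finset.card_pos.2 ⟨x, hx⟩
  obtain ⟨h, e1, e2, e3, e4, e5⟩ := exists_swap_labelling hx hy hxS hyS
  obtain ⟨σ, hσ⟩ := exists_equiv_lt_iff hα h
  obtain ⟨r, hr⟩ : ∃ r, (A ∩ S).card = r := ⟨_, rfl⟩
  have hr0 : 0 < r := hr ▸ Finset.card_pos.2 ⟨x, Finset.mem_inter.2 ⟨hx, hxS⟩⟩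
  have hrm : r ≤ m := by
    rw [← hr, ← hAm]
    exact Finset.card_le_card Finset.inter_subset_left
  have c1 := fun i => hσ i 1
  have c2 := fun i => hσ i 2
  have c3 := fun i => hσ i 3
  have c4 := fun i => hσ i 4
  have c5 := fun i => hσ i 5
  have hSA : (S \ A).card + r = m := by
    rw [← hr, ← hSm, Finset.inter_comm]
    exact Finset.card_sdiff_add_card_inter S A
  simp only [e1, Finset.filter_univ_mem, Finset.card_singleton] at c1
  simp only [e2, Finset.filter_univ_mem, hr] at c2
  simp only [e3, Finset.filter_univ_mem, hAm] at c3
  simp only [e4, Finset.filter_univ_mem, Finset.card_insert_of_notMem hy, hAm] at c4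
  simp only [e5, Finset.filter_univ_mem, Finset.card_compl, hα,
    show 2 * m - (S \ A).card = m + r by omega] at c5
  have hpos : ∀ i : ZMod (2 * m), ∀ (j : ℕ) (k : ℕ), j < 2 * m →
      (σ i ∈ arc σ (j : ZMod (2 * m)) k ↔
        (j ≤ i.val ∧ i.val < j + k) ∨ (i.val < j ∧ i.val + 2 * m < j + k)) := by
    intro i j k hj
    have := apply_add_mem_arc_add σ 0 (i := i.val) (j := j) k (ZMod.val_lt i) hj
    simpa using this
  have hA0 : arc σ ((0 : ℕ) : ZMod (2 * m)) m = A := by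
    ext a
    obtain ⟨i, rfl⟩ := σ.surjective a
    rw [hpos _ _ _ (by omega), c3]
    omega
  have hA1 : arc σ ((1 : ℕ) : ZMod (2 * m)) m = insert y (A.erase x) := by
    ext a
    obtain ⟨i, rfl⟩ := σ.surjective a
    have h1 := c1 i
    have h3 := c3 i
    have h4 := c4 i
    rw [Finset.mem_singleton] at h1
    rw [Finset.mem_insert] at h4
    rw [hpos _ _ _ (by omega), Finset.mem_insert, Finset.mem_erase]
    have hlt := ZMod.val_lt i
    by_cases ha : σ i = y
    · have : σ i ∉ A := ha ▸ hy
      simp only [ha, true_or, iff_true]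
      have h4 := h4.1 (Or.inl ha)
      have h3 := mt h3.2 this
      omega
    · simp only [ha, false_or] at h4 ⊢
      rw [Ne, h1, h3]
      have : i.val ≠ m := fun h => by
        have h5 := h4.2 (by omega)
        rw [h3] at h5
        omega
      omega
  have hS : arc σ ((((m + r) % (2 * m) : ℕ)) : ZMod (2 * m)) m = S := by
    ext a
    obtain ⟨i, rfl⟩ := σ.surjective a
    have h2 := c2 i
    have h3 := c3 i
    have h5 := c5 i
    rw [hpos _ _ _ (Nat.mod_lt _ (by omega))]
    have hlt := ZMod.val_lt i
    have hiff : σ i ∈ S ↔ (i.val < r ∨ m + r ≤ i.val) := by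
      rw [← not_lt, ← h2, ← h5]
      simp only [Finset.mem_inter, Finset.mem_compl, Finset.mem_sdiff]
      tauto
    rw [hiff]
    rcases hrm.lt_or_eq with h | h
    · rw [Nat.mod_eq_of_lt (by omega)]
      omega
    · rw [show m + r = 2 * m by omega, Nat.mod_self]
      omega
  obtain ⟨z, hz⟩ := hF σ
  have hz0 := (hz.half ((0 : ℕ) : ZMod (2 * m))).1 (by rwa [hA0])
  have hz1 := mt (hz.half ((1 : ℕ) : ZMod (2 * m))).2 (by rwa [hA1])
  rw [hA0] at hz0
  rw [hA1, Finset.mem_insert, Finset.mem_erase] at hz1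
  have hzx : z = x := by tauto
  subst hzx
  rw [← hS, hz.half, hS]
  exact hxS

end Uniqueness

section Conclusion

variable {m : ℕ} [NeZero (2 * m)] {α : Type*} [DecidableEq α] [Fintype α] {F : Finset (Finset α)}

lemma mem_iff_compl_notMem (hα : Fintype.card α = 2 * m)
    (hF : ∀ σ : ZMod (2 * m) ≃ α, ∃ x, IsCentre m F σ x) {S : Finset α} (hS : S.card = m) :
    S ∈ F ↔ Sᶜ ∉ F := by
  obtain ⟨σ, hσ⟩ := exists_arc_zero_eq hα S
  rw [hS] at hσ
  obtain ⟨x, hx⟩ := hF σ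
  have h := compl_arc hα σ
  rw [hσ] at h
  have h1 := hx.half 0
  have h2 := hx.half (m : ℕ)
  rw [hσ] at h1
  rw [← h] at h2
  rw [h1, h2, Finset.mem_compl, not_not]

omit [DecidableEq α] in
lemma mem_of_card_eq_succ (hα : Fintype.card α = 2 * m)
    (hF : ∀ σ : ZMod (2 * m) ≃ α, ∃ x, IsCentre m F σ x) {S : Finset α} (hS : S.card = m + 1) :
    S ∈ F := by
  obtain ⟨σ, hσ⟩ := exists_arc_zero_eq hα S
  obtain ⟨x, hx⟩ := hF σ
  rw [← hσ, hS]
  exact hx.succ 0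

omit [Fintype α] in
lemma card_insert_erase_of_mem {S : Finset α} {x y : α} (hx : x ∈ S) (hy : y ∉ S) :
    (insert y (S.erase x)).card = S.card := by
  rw [Finset.card_insert_of_notMem fun h => hy (Finset.mem_of_mem_erase h),
    Finset.card_erase_add_one hx]

/-- A set of size `m + 2` in `F` contains no member of `F` of size `m`. -/
lemma not_subset_of_card_eq_add_two (hα : Fintype.card α = 2 * m) (hC : chainTriples F = ∅)
    (hF : ∀ σ : ZMod (2 * m) ≃ α, ∃ x, IsCentre m F σ x) {S T : Finset α} (hS : S ∈ F)
    (hSm : S.card = m + 2) (hT : T ∈ F) (hTm : T.card = m) : ¬ T ⊆ S := by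
  intro hTS
  obtain ⟨U, hTU, hUS, hU⟩ := Finset.exists_subsuperset_card_eq hTS (n := m + 1)
    (by omega) (by omega)
  have hUF := mem_of_card_eq_succ hα hF hU
  have : (T, U, S) ∈ chainTriples F := mem_chainTriples.2 ⟨hT, hUF, hS,
    hTU.ssubset_of_ne fun h => by rw [h] at hTm; omega,
    hUS.ssubset_of_ne fun h => by rw [h] at hU; omega⟩
  rw [hC] at this
  simp at this

lemma exists_forall_half_mem_iff (hα : Fintype.card α = 2 * m) (hm : 3 ≤ m)
    (hC : chainTriples F = ∅) (hF : ∀ σ : ZMod (2 * m) ≃ α, ∃ x, IsCentre m F σ x) :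
    ∃ x, ∀ S : Finset α, S.card = m → (S ∈ F ↔ x ∈ S) := by
  obtain ⟨σ, -⟩ := exists_arc_zero_eq hα ∅
  obtain ⟨x, hx⟩ := hF σ
  obtain ⟨q, rfl⟩ := σ.surjective x
  obtain ⟨y, hy⟩ : ∃ y, y = σ (q + (m : ℕ)) := ⟨_, rfl⟩
  have hpos : ∀ i j k : ℕ, i < 2 * m → j < 2 * m →
      (σ (q + (i : ℕ)) ∈ arc σ (q + (j : ℕ)) k ↔
        (j ≤ i ∧ i < j + k) ∨ (i < j ∧ i + 2 * m < j + k)) :=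
    fun i j k hi hj => apply_add_mem_arc_add σ q k hi hj
  have hxpos : ∀ j k : ℕ, j < 2 * m → (σ q ∈ arc σ (q + (j : ℕ)) k ↔
        (j = 0 ∧ 0 < k) ∨ (0 < j ∧ 2 * m < j + k)) := by
    intro j k hj
    have := hpos 0 j k (by omega) hj
    rw [Nat.cast_zero, add_zero] at this
    rw [this]
    omega
  have hA : arc σ (q + (0 : ℕ)) m ∈ F := by
    rw [hx.half, hxpos _ _ (by omega)]
    omega
  have hxA : σ q ∈ arc σ (q + (0 : ℕ)) m := (hx.half _).1 hA
  have hyA : y ∉ arc σ (q + (0 : ℕ)) m := by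
    rw [hy, hpos _ _ _ (by omega) (by omega)]
    omega
  have hA1 : arc σ (q + (1 : ℕ)) m = insert y ((arc σ (q + (0 : ℕ)) m).erase (σ q)) := by
    refine Finset.eq_of_subset_of_card_le (fun a ha => ?_) ?_
    · obtain ⟨b, rfl⟩ := σ.surjective a
      obtain ⟨i, hi, rfl⟩ := exists_eq_add_natCast q b
      rw [hpos _ _ _ hi (by omega)] at ha
      rw [Finset.mem_insert, Finset.mem_erase, hpos _ _ _ hi (by omega)]
      rcases (by omega : i = m ∨ i ≠ m) with h | h
      · exact Or.inl (by rw [hy, h])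
      · refine Or.inr ⟨fun h0 => ?_, by omega⟩
        have h1 := hxpos 1 m (by omega)
        rw [← h0, hpos _ _ _ hi (by omega)] at h1
        omega
    · rw [card_insert_erase_of_mem hxA hyA, card_arc σ _ (by omega), card_arc σ _ (by omega)]
  have hA1F : insert y ((arc σ (q + (0 : ℕ)) m).erase (σ q)) ∉ F := by
    rw [← hA1, hx.half, hxpos _ _ (by omega)]
    omega
  have hxy : σ q ≠ y := fun h => hyA (h ▸ hxA)
  have key : ∀ S : Finset α, S.card = m → σ q ∈ S → y ∉ S → S ∈ F := fun S hS h1 h2 =>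
    mem_of_swap_not_mem hα hF hA (card_arc σ _ (by omega)) hxA hyA hA1F hS h1 h2
  set D := arc σ (q + (1 : ℕ)) (m + 2) with hD
  have hDm : D.card = m + 2 := card_arc σ _ (by omega)
  have hDF : D ∈ F := by
    rw [hx.upper, hxpos _ _ (by omega)]
    omega
  have hyD : y ∈ D := by
    rw [hy, hpos _ _ _ (by omega) (by omega)]
    omega
  have key' : ∀ U : Finset α, U.card = m → σ q ∈ U → U ∈ F := by
    intro U hU hxU
    by_contra hUF
    have hyU : y ∈ U := by
      by_contra hyU
      exact hUF (key U hU hxU hyU)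
    have hUc : Uᶜ.card = m := by
      rw [Finset.card_compl, hα]
      omega
    have hUcF : Uᶜ ∈ F := by
      by_contra h
      exact hUF ((mem_iff_compl_notMem hα hF hU).2 h)
    obtain ⟨z, hz⟩ : (Uᶜ ∩ D).Nonempty := by
      rw [← Finset.card_pos]
      have h1 := Finset.card_union_add_card_inter Uᶜ D
      have h2 := (Uᶜ ∪ D).card_le_univ
      omega
    rw [Finset.mem_inter, Finset.mem_compl] at hz
    have hswap : insert y (Uᶜ.erase z) ∉ F := by
      have hc : (insert z (U.erase y))ᶜ = insert y (Uᶜ.erase z) := by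
        ext a
        simp only [Finset.mem_compl, Finset.mem_insert, Finset.mem_erase]
        have : y ≠ z := fun h => hz.1 (h ▸ hyU)
        grind
      have hcard : (insert z (U.erase y)).card = m := by
        rw [card_insert_erase_of_mem hyU hz.1, hU]
      rw [← hc, ← mem_iff_compl_notMem hα hF hcard]
      refine key _ hcard ?_ ?_
      · exact Finset.mem_insert_of_mem (Finset.mem_erase.2 ⟨hxy, hxU⟩)
      · rw [Finset.mem_insert, Finset.mem_erase]
        have : y ≠ z := fun h => hz.1 (h ▸ hyU)
        simp [this]
    have hyz : z ≠ y := fun h => hz.1 (h ▸ hyU)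
    obtain ⟨T, hzT, hTD, hT⟩ := Finset.exists_subsuperset_card_eq
      (Finset.singleton_subset_iff.2 (Finset.mem_erase.2 ⟨hyz, hz.2⟩)) (n := m)
      (by rw [Finset.card_singleton]; omega) (by rw [Finset.card_erase_of_mem hyD]; omega)
    have hTF := mem_of_swap_not_mem hα hF hUcF hUc (Finset.mem_compl.2 hz.1)
      (by simpa using hyU) hswap hT (Finset.singleton_subset_iff.1 hzT)
      fun h => Finset.notMem_erase y D (hTD h)
    exact not_subset_of_card_eq_add_two hα hC hF hDF hDm hTF hT
      (hTD.trans (Finset.erase_subset _ _))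
  refine ⟨σ q, fun S hS => ⟨fun h => ?_, key' S hS⟩⟩
  by_contra hxS
  exact (mem_iff_compl_notMem hα hF hS).1 h (key' Sᶜ (by rw [Finset.card_compl, hα]; omega)
    (Finset.mem_compl.2 hxS))

lemma upper_mem_iff (hα : Fintype.card α = 2 * m) (hm : 3 ≤ m) (hC : chainTriples F = ∅)
    (hF : ∀ σ : ZMod (2 * m) ≃ α, ∃ x, IsCentre m F σ x) {x : α}
    (hx : ∀ S : Finset α, S.card = m → (S ∈ F ↔ x ∈ S)) {S : Finset α} (hS : S.card = m + 2) :
    S ∈ F ↔ x ∉ S := by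
  constructor
  · intro hSF hxS
    obtain ⟨T, hxT, hTS, hT⟩ := Finset.exists_subsuperset_card_eq
      (Finset.singleton_subset_iff.2 hxS) (n := m) (by rw [Finset.card_singleton]; omega)
      (by omega)
    exact not_subset_of_card_eq_add_two hα hC hF hSF hS
      ((hx T hT).2 (Finset.singleton_subset_iff.1 hxT)) hT hTS
  · intro hxS
    obtain ⟨σ, hσ⟩ := exists_arc_zero_eq hα S
    rw [hS] at hσ
    obtain ⟨z, hz⟩ := hF σ
    by_contra hSF
    have hzS : z ∈ S := by
      have := mt (hz.upper 0).2 (by rwa [hσ])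
      rwa [not_not, hσ] at this
    obtain ⟨b, rfl⟩ := σ.surjective z
    obtain ⟨i, hi, rfl⟩ := exists_eq_add_natCast 0 b
    have hpos := fun j k hj => apply_add_mem_arc_add σ 0 (i := i) (j := j) k hi hj
    obtain ⟨j, hj, hij⟩ : ∃ j ≤ 2, j ≤ i ∧ i < j + m := by
      have := hpos 0 (m + 2) (by omega)
      rw [Nat.cast_zero, add_zero, hσ] at this
      have := this.1 hzS
      rcases lt_or_ge i m with h | h
      · exact ⟨0, by omega, by omega, by omega⟩
      · exact ⟨2, by omega, by omega, by omega⟩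
    have hjF : arc σ (0 + (j : ℕ)) m ∈ F := by
      rw [hz.half, hpos _ _ (by omega)]
      exact Or.inl hij
    have hxj := (hx _ (card_arc σ _ (by omega))).1 hjF
    have hsub := arc_subset σ 0 (i := j) (k := m) (l := m + 2) (by omega) (by omega)
    rw [hσ] at hsub
    exact hxS (hsub hxj)

lemma exists_eq_filter (hα : Fintype.card α = 2 * m) (hm : 9 ≤ m) (hF : Intersecting F)
    (hB : ButterflyFree F) (hcard : F.card = SigmaI (2 * m) 2) :
    ∃ x, F = Finset.univ.filter fun S : Finset α =>
      (S.card = m ∧ x ∈ S) ∨ S.card = m + 1 ∨ (S.card = m + 2 ∧ x ∉ S) := by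
  obtain ⟨hC, hperf⟩ := chainTriples_eq_empty_and_isPerfect hα hF hB hm hcard
  have hcentre : ∀ σ : ZMod (2 * m) ≃ α, ∃ x, IsCentre m F σ x := fun σ => by
    obtain ⟨p, hp⟩ := (isArcFamily_selectedArcs hF σ).exists_isStandardAt (by omega) (hperf σ)
    exact ⟨_, hp.isCentre (by omega) hC⟩
  obtain ⟨x, hx⟩ := exists_forall_half_mem_iff hα (by omega) hC hcentre
  have hsize : ∀ S ∈ F, S.card = m ∨ S.card = m + 1 ∨ S.card = m + 2 := by
    intro S hS
    have hS0 : 0 < S.card := by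
      obtain ⟨a, ha⟩ := hF S hS S hS
      exact Finset.card_pos.2 ⟨a, Finset.mem_of_mem_inter_left ha⟩
    have hS1 : S.card ≤ 2 * m := hα ▸ S.card_le_univ
    obtain ⟨σ, hσ⟩ := exists_arc_zero_eq hα S
    obtain ⟨z, hz⟩ := hcentre σ
    rcases hS1.lt_or_eq with h | h
    · exact hz.length 0 _ hS0 h (by rwa [hσ])
    · have hu : S = Finset.univ := by rw [← Finset.card_eq_iff_eq_univ, h, hα]
      obtain ⟨T, hxT, -, hT⟩ := Finset.exists_subsuperset_card_eq
        (Finset.subset_univ ({x} : Finset α)) (n := m)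
        (by rw [Finset.card_singleton]; omega) (by rw [Finset.card_univ, hα]; omega)
      obtain ⟨U, hTU, -, hU⟩ := Finset.exists_subsuperset_card_eq (Finset.subset_univ T)
        (n := m + 1) (by omega) (by rw [Finset.card_univ, hα]; omega)
      have : (T, U, S) ∈ chainTriples F := mem_chainTriples.2
        ⟨(hx T hT).2 (Finset.singleton_subset_iff.1 hxT), mem_of_card_eq_succ hα hcentre hU, hS,
        hTU.ssubset_of_ne fun h' => by rw [h'] at hT; omega,
        (hu ▸ U.subset_univ).ssubset_of_ne fun h' => by rw [h'] at hU; omega⟩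
      rw [hC] at this
      simp at this
  refine ⟨x, Finset.ext fun S => ?_⟩
  rw [Finset.mem_filter]
  simp only [Finset.mem_univ, true_and]
  constructor
  · intro hS
    rcases hsize S hS with h | h | h
    · exact Or.inl ⟨h, (hx S h).1 hS⟩
    · exact Or.inr (Or.inl h)
    · exact Or.inr (Or.inr ⟨h, (upper_mem_iff hα (by omega) hC hcentre hx h).1 hS⟩)
  · rintro (⟨h, h'⟩ | h | ⟨h, h'⟩)
    · exact (hx S h).2 h'
    · exact mem_of_card_eq_succ hα hcentre h
    · exact (upper_mem_iff hα (by omega) hC hcentre hx h).2 h'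

end Conclusion

theorem intersecting_butterflyFree_eq_even (n : ℕ) (hn : 18 ≤ n) (heven : n % 2 = 0)
    (F : Finset (Finset (Fin n))) (hF : Intersecting F) (hB : ButterflyFree F)
    (hcard : F.card = SigmaI n 2) :
    ∃ x : Fin n, F = Finset.univ.filter (fun S : Finset (Fin n) =>
      (S.card = n / 2 ∧ x ∈ S) ∨ S.card = n / 2 + 1 ∨
        (S.card = n / 2 + 2 ∧ x ∉ S)) := by
  obtain ⟨m, rfl⟩ : ∃ m, n = 2 * m := ⟨n / 2, by omega⟩
  have : NeZero (2 * m) := ⟨by omega⟩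
  rw [Nat.mul_div_cancel_left m (by norm_num)]
  exact exists_eq_filter (Fintype.card_fin _) (by omega) hF hB hcard
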